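/- Suppose Conditions 2.1, 4.1 (with parameter θ₁) and 4.3 (with parameters θ₂, θ₃) are met. Then for any ω ∈ (0, min{ θ₁/(2(1−θ₁)), θ₂/(2(1−θ₂)), θ₃ − 1/2 }): sup_{u ∈ N(n^{−1/2}, 1/2)} | 𝔺_n(u)/g_ω(u) − C̄_n(u)/g_ω(u) | = o_P(1) as n → ∞. -/

import Mathlib

open MeasureTheory Filter Set
open scoped ENNReal NNReal

noncomputable section

namespace BBV

variable {Ω : Type*} [MeasurableSpace Ω] {E : Type*} [MeasurableSpace E] {d : ℕ}

/-- The real-valued indicator function of a set. -/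
def indic {α : Type*} (s : Set α) (x : α) : ℝ := s.indicator (fun _ => (1 : ℝ)) x

/-- `Z n = o_P(r n)`: convergence to zero in (outer) probability at rate `r`. -/
def oP (P : Measure Ω) (Z : ℕ → Ω → ℝ) (r : ℕ → ℝ) : Prop :=
  ∀ ε : ℝ, 0 < ε → Tendsto (fun n => P {ω | ε * r n < |Z n ω|}) atTop (nhds 0)

/-- `Z n = o_P(1)`: convergence to zero in (outer) probability. -/
def oP1 (P : Measure Ω) (Z : ℕ → Ω → ℝ) : Prop := oP P Z fun _ => 1

/-- `Z n = O_P(1)`: boundedness in (outer) probability. -/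
def bigOP (P : Measure Ω) (Z : ℕ → Ω → ℝ) : Prop :=
  ∀ ε : ℝ, 0 < ε → ∃ M : ℝ, ∀ᶠ n in atTop, P {ω | M < |Z n ω|} ≤ ENNReal.ofReal ε

/-- Strict stationarity of a two-sided sequence: all finite-dimensional distributions
are invariant under shifts. -/
def StrictlyStationary (P : Measure Ω) (X : ℤ → Ω → E) : Prop :=
  ∀ (m : ℕ) (idx : Fin m → ℤ) (k : ℤ),
    Measure.map (fun ω (p : Fin m) => X (idx p + k) ω) P =
      Measure.map (fun ω (p : Fin m) => X (idx p) ω) P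

/-- The sigma-field generated by the variables `X i`, `i ∈ S`. -/
def mixSigma (X : ℤ → Ω → E) (S : Set ℤ) : MeasurableSpace Ω :=
  ⨆ i ∈ S, MeasurableSpace.comap (X i) inferInstance

/-- The alpha-mixing coefficient of the sequence `X`. -/
def alphaMix (P : Measure Ω) (X : ℤ → Ω → E) (k : ℕ) : ℝ :=
  sSup {r : ℝ | ∃ (i : ℤ) (A B : Set Ω),
    MeasurableSet[mixSigma X (Set.Iic i)] A ∧
    MeasurableSet[mixSigma X (Set.Ici (i + (k : ℤ)))] B ∧
    r = |(P (A ∩ B)).toReal - (P A).toReal * (P B).toReal|}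

/-- Exponentially decaying alpha-mixing coefficients: `α(k) = O(a^k)` for some `a ∈ (0,1)`. -/
def ExpAlphaMixing (P : Measure Ω) (X : ℤ → Ω → E) : Prop :=
  ∃ a ∈ Set.Ioo (0 : ℝ) 1, ∃ c : ℝ, ∀ k : ℕ, 1 ≤ k → alphaMix P X k ≤ c * a ^ k

/-- Marginal c.d.f. `F_j` of the stationary sequence. -/
def margF (P : Measure Ω) (X : ℤ → Ω → Fin d → ℝ) (j : Fin d) (x : ℝ) : ℝ :=
  (P {ω | X 0 ω j ≤ x}).toReal

/-- `U_i = (F_1(X_{i1}),…,F_d(X_{id}))`. -/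
def Uv (P : Measure Ω) (X : ℤ → Ω → Fin d → ℝ) (i : ℤ) (ω : Ω) (j : Fin d) : ℝ :=
  margF P X j (X i ω j)

/-- The copula `C` of the stationary distribution, i.e. the c.d.f. of `U_0`. -/
def cop (P : Measure Ω) (X : ℤ → Ω → Fin d → ℝ) (u : Fin d → ℝ) : ℝ :=
  (P {ω | ∀ j, Uv P X 0 ω j ≤ u j}).toReal

/-- Empirical c.d.f. `G_n` of the (unobservable) sample `U_1,…,U_n`. -/
def Gn (P : Measure Ω) (X : ℤ → Ω → Fin d → ℝ) (n : ℕ) (u : Fin d → ℝ) (ω : Ω) : ℝ :=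
  (n : ℝ)⁻¹ * ∑ i ∈ Finset.Icc (1 : ℤ) (n : ℤ), indic {ω' | ∀ j, Uv P X i ω' j ≤ u j} ω

/-- The empirical process `α_n = √n (G_n − C)`. -/
def alphan (P : Measure Ω) (X : ℤ → Ω → Fin d → ℝ) (n : ℕ) (u : Fin d → ℝ) (ω : Ω) : ℝ :=
  Real.sqrt n * (Gn P X n u ω - cop P X u)

/-- Marginal empirical c.d.f. `G_{nj}` based on `U_{1j},…,U_{nj}`. -/
def Gnj (P : Measure Ω) (X : ℤ → Ω → Fin d → ℝ) (n : ℕ) (j : Fin d) (s : ℝ) (ω : Ω) : ℝ :=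
  (n : ℝ)⁻¹ * ∑ i ∈ Finset.Icc (1 : ℤ) (n : ℤ), indic {ω' | Uv P X i ω' j ≤ s} ω

/-- The marginal empirical process `α_{nj}(s) = √n (G_{nj}(s) − s)`. -/
def alphanj (P : Measure Ω) (X : ℤ → Ω → Fin d → ℝ) (n : ℕ) (j : Fin d) (s : ℝ) (ω : Ω) : ℝ :=
  Real.sqrt n * (Gnj P X n j s ω - s)

/-- Left-continuous generalized inverse: `H⁻(s) = inf{x : H(x) ≥ s}` for `s ≠ 0`,
and `H⁻(0) = sup{x : H(x) = 0}`. -/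
def genInv (H : ℝ → ℝ) (s : ℝ) : ℝ :=
  if s = 0 then sSup {x | H x = 0} else sInf {x | s ≤ H x}

/-- The marginal quantile process `β_{nj}(s) = √n (G_{nj}⁻(s) − s)`. -/
def betanj (P : Measure Ω) (X : ℤ → Ω → Fin d → ℝ) (n : ℕ) (j : Fin d) (s : ℝ) (ω : Ω) : ℝ :=
  Real.sqrt n * (genInv (fun x => Gnj P X n j x ω) s - s)

/-- Marginal empirical c.d.f. `F_{nj}` of the observations `X_{1j},…,X_{nj}`. -/
def empCdfX (X : ℤ → Ω → Fin d → ℝ) (n : ℕ) (j : Fin d) (x : ℝ) (ω : Ω) : ℝ :=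
  (n : ℝ)⁻¹ * ∑ i ∈ Finset.Icc (1 : ℤ) (n : ℤ), indic {ω' | X i ω' j ≤ x} ω

/-- Pseudo-observations `Û_{ij} = n/(n+1) · F_{nj}(X_{ij})`. -/
def pseudoObs (X : ℤ → Ω → Fin d → ℝ) (n : ℕ) (i : ℤ) (ω : Ω) (j : Fin d) : ℝ :=
  (n : ℝ) / ((n : ℝ) + 1) * empCdfX X n j (X i ω j) ω

/-- The empirical copula `Ĉ_n`. -/
def empCop (X : ℤ → Ω → Fin d → ℝ) (n : ℕ) (u : Fin d → ℝ) (ω : Ω) : ℝ :=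
  (n : ℝ)⁻¹ * ∑ i ∈ Finset.Icc (1 : ℤ) (n : ℤ), indic {ω' | ∀ j, pseudoObs X n i ω' j ≤ u j} ω

/-- The empirical copula process `ĈP_n = √n (Ĉ_n − C)`. -/
def hatCP (P : Measure Ω) (X : ℤ → Ω → Fin d → ℝ) (n : ℕ) (u : Fin d → ℝ) (ω : Ω) : ℝ :=
  Real.sqrt n * (empCop X n u ω - cop P X u)

/-- First-order partial derivative `Ċ_j` of `C`, defined everywhere as the limsup of
difference quotients (which coincides with the partial derivative wherever it exists). -/
def Cdot (C : (Fin d → ℝ) → ℝ) (j : Fin d) (u : Fin d → ℝ) : ℝ :=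
  Filter.limsup (fun h : ℝ => (C (Function.update u j (u j + h)) - C u) / h)
    (nhdsWithin 0 {(0 : ℝ)}ᶜ)

/-- The process `C̄_n(u) = α_n(u) − Σ_j Ċ_j(u) α_n(u^{(j)})`. -/
def Cbar (P : Measure Ω) (X : ℤ → Ω → Fin d → ℝ) (n : ℕ) (u : Fin d → ℝ) (ω : Ω) : ℝ :=
  alphan P X n u ω -
    ∑ j, Cdot (cop P X) j u * alphan P X n (Function.update (fun _ => (1 : ℝ)) j (u j)) ω

/-- `C_n(u) = G_n(G_{n1}⁻(u₁),…,G_{nd}⁻(u_d))`. -/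
def copGI (P : Measure Ω) (X : ℤ → Ω → Fin d → ℝ) (n : ℕ) (u : Fin d → ℝ) (ω : Ω) : ℝ :=
  Gn P X n (fun j => genInv (fun x => Gnj P X n j x ω) (u j)) ω

/-- The empirical copula process `𝔺_n = √n (C_n − C)` based on generalized inverses. -/
def CPgi (P : Measure Ω) (X : ℤ → Ω → Fin d → ℝ) (n : ℕ) (u : Fin d → ℝ) (ω : Ω) : ℝ :=
  Real.sqrt n * (copGI P X n u ω - cop P X u)

/-- `g₁(u) = min{ min_j u_j , min_j [1 − min_{k ≠ j} u_k] }`. -/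
def g1 (u : Fin d → ℝ) : ℝ :=
  min (⨅ j, u j) (⨅ j : Fin d, (1 - ⨅ k : {k : Fin d // k ≠ j}, u (k : Fin d)))

/-- The weight function `g_ω(u) = g₁(u)^ω`. -/
def gW (w : ℝ) (u : Fin d → ℝ) : ℝ := g1 u ^ w

/-- `g̃_ω(u) = g_ω(u) + 1{g_ω(u) = 0}`. -/
def gTilde (w : ℝ) (u : Fin d → ℝ) : ℝ := if gW w u = 0 then 1 else gW w u

/-- `N(a,b) = {u ∈ [0,1]^d : a < g₁(u) ≤ b}`. -/
def NN (d : ℕ) (a b : ℝ) : Set (Fin d → ℝ) :=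
  {u | (∀ j, 0 ≤ u j ∧ u j ≤ 1) ∧ a < g1 u ∧ g1 u ≤ b}

/-- `V_j = {u ∈ [0,1]^d : u_j ∈ (0,1)}`. -/
def VV (d : ℕ) (j : Fin d) : Set (Fin d → ℝ) :=
  {u | (∀ k, 0 ≤ u k ∧ u k ≤ 1) ∧ 0 < u j ∧ u j < 1}

/-- Condition 2.1: existence, continuity and growth bounds for the first and second
order partial derivatives of the copula `C`. -/
def Condition21 (C : (Fin d → ℝ) → ℝ) : Prop :=
  (∀ j : Fin d, ∀ u ∈ VV d j,
    HasDerivAt (fun t => C (Function.update u j t)) (Cdot C j u) (u j)) ∧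
  (∀ j : Fin d, ContinuousOn (Cdot C j) (VV d j)) ∧
  ∃ Cdd : Fin d → Fin d → (Fin d → ℝ) → ℝ,
    (∀ j₁ j₂ : Fin d, ∀ u ∈ VV d j₁ ∩ VV d j₂,
      HasDerivAt (fun t => Cdot C j₂ (Function.update u j₁ t)) (Cdd j₁ j₂ u) (u j₁)) ∧
    (∀ j₁ j₂ : Fin d, ContinuousOn (Cdd j₁ j₂) (VV d j₁ ∩ VV d j₂)) ∧
    ∃ K : ℝ, 0 < K ∧ ∀ j₁ j₂ : Fin d, ∀ u ∈ VV d j₁ ∩ VV d j₂,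
      |Cdd j₁ j₂ u| ≤ K * min (1 / (u j₁ * (1 - u j₁))) (1 / (u j₂ * (1 - u j₂)))

/-- The weighted modulus of continuity `M_n(δ,μ)` of the empirical process. -/
def Mn (P : Measure Ω) (X : ℤ → Ω → Fin d → ℝ) (n : ℕ) (δ μ : ℝ) (ω : Ω) : ℝ :=
  ⨆ q ∈ {q : (Fin d → ℝ) × (Fin d → ℝ) |
      q.1 ∈ Set.Icc 0 1 ∧ q.2 ∈ Set.Icc 0 1 ∧ dist q.1 q.2 ≤ δ},
    |alphan P X n q.1 ω - alphan P X n q.2 ω| / max (dist q.1 q.2 ^ μ) ((n : ℝ) ^ (-μ))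

/-- Condition 4.1 with parameter `θ₁`. -/
def Condition41 (P : Measure Ω) (X : ℤ → Ω → Fin d → ℝ) (θ₁ : ℝ) : Prop :=
  ∀ μ ∈ Set.Ioo (0 : ℝ) θ₁, ∀ δ : ℕ → ℝ, Tendsto δ atTop (nhds 0) →
    oP1 P (fun n ω => Mn P X n (δ n) μ ω)

/-- Condition 4.3 with parameters `θ₂, θ₃`. -/
def Condition43 (P : Measure Ω) (X : ℤ → Ω → Fin d → ℝ) (θ₂ θ₃ : ℝ) : Prop :=
  ∀ w ∈ Set.Ioo (0 : ℝ) θ₂, ∀ lam ∈ Set.Ioo (0 : ℝ) θ₃, ∀ j : Fin d,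
    bigOP P (fun n ω => ⨆ s ∈ Set.Ioo (0 : ℝ) 1,
      |alphanj P X n j s ω| / (s * (1 - s)) ^ w) ∧
    bigOP P (fun n ω => ⨆ s ∈ Set.Ioo ((n : ℝ) ^ (-lam)) (1 - (n : ℝ) ^ (-lam)),
      |betanj P X n j s ω| / (s * (1 - s)) ^ w)

lemma le_biSup_of_bounded {ι : Type*} {S : Set ι} {f : ι → ℝ} {c : ℝ} (hc : 0 ≤ c)
    (hf : ∀ q ∈ S, f q ≤ c) {q : ι} (hq : q ∈ S) : f q ≤ ⨆ r ∈ S, f r := by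
  refine le_ciSup_of_le (f := fun r => ⨆ (_ : r ∈ S), f r) ⟨c, ?_⟩ q ?_
  · rintro _ ⟨r, rfl⟩
    exact Real.iSup_le (hf r) hc
  · simp [hq]

/-- If moving one coordinate at a time inside the box spanned by `u` and `z` changes `f` by at
most `b k`, then `f` changes by at most the sum of the `b k` between `u` and `z`. -/
lemma abs_sub_le_sum_of_step (f : (Fin d → ℝ) → ℝ) (u z : Fin d → ℝ) (b : Fin d → ℝ)
    (J : Finset (Fin d))
    (h : ∀ k ∈ J, ∀ p : Fin d → ℝ, (∀ i, p i ∈ Set.uIcc (u i) (z i)) →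
      |f p - f (Function.update p k (u k))| ≤ b k)
    (hz : ∀ k ∉ J, z k = u k) : |f z - f u| ≤ ∑ k ∈ J, b k := by
  have key : ∀ S : Finset (Fin d), S ⊆ J → |f (S.piecewise z u) - f u| ≤ ∑ k ∈ S, b k := by
    intro S
    induction S using Finset.induction_on with
    | empty => simp
    | insert k S hk ih =>
      intro hS
      have h1 := ih ((Finset.subset_insert k S).trans hS)
      have h2 := h k (hS (Finset.mem_insert_self k S)) ((insert k S).piecewise z u) (by
        intro i
        by_cases hi : i ∈ insert k S
        · rw [Finset.piecewise_eq_of_mem _ _ _ hi]; exact Set.right_mem_uIcc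
        · rw [Finset.piecewise_eq_of_notMem _ _ _ hi]; exact Set.left_mem_uIcc)
      have h3 : Function.update ((insert k S).piecewise z u) k (u k) = S.piecewise z u := by
        ext i
        by_cases hi : i = k
        · subst hi; simp [hk]
        · simp [Finset.piecewise, hi]
      rw [h3] at h2
      rw [Finset.sum_insert hk]
      calc _ ≤ _ := abs_sub_le _ (f (S.piecewise z u)) _
        _ ≤ _ := add_le_add h2 h1
  have h4 : J.piecewise z u = z := by
    ext i
    by_cases hi : i ∈ J
    · simp [hi]
    · simp [hi, hz i hi]
  simpa [h4] using key J subset_rfl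

/-- One-dimensional mean value theorem on an unordered interval. -/
lemma exists_sub_eq_mul_of_hasDerivAt {f f' : ℝ → ℝ} {a b : ℝ}
    (hf : ∀ x ∈ Set.uIcc a b, HasDerivAt f (f' x) x) :
    ∃ c ∈ Set.uIcc a b, f b - f a = f' c * (b - a) := by
  have main : ∀ a b : ℝ, a < b → (∀ x ∈ Set.Icc a b, HasDerivAt f (f' x) x) →
      ∃ c ∈ Set.Icc a b, f b - f a = f' c * (b - a) := by
    intro a b hab hf
    obtain ⟨c, hc, h⟩ := exists_hasDerivAt_eq_slope f f' hab
      (fun x hx => (hf x hx).continuousAt.continuousWithinAt)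
      (fun x hx => hf x ⟨hx.1.le, hx.2.le⟩)
    refine ⟨c, ⟨hc.1.le, hc.2.le⟩, ?_⟩
    rw [h, div_mul_cancel₀ _ (sub_pos.2 hab).ne']
  rcases lt_trichotomy a b with h | h | h
  · rw [Set.uIcc_of_le h.le] at hf ⊢
    exact main a b h hf
  · exact ⟨a, Set.left_mem_uIcc, by simp [h]⟩
  · rw [Set.uIcc_of_ge h.le] at hf ⊢
    obtain ⟨c, hc, h⟩ := main b a h hf
    exact ⟨c, hc, by linarith⟩

lemma mem_uIcc_bounds {a b η : ℝ} (ha : 0 < a) (ha1 : a < 1)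
    (hab : |b - a| ≤ a * (1 - a) / 2) (hη : η ∈ Set.uIcc a b) :
    0 < η ∧ η < 1 ∧ a * (1 - a) / 4 ≤ η * (1 - η) := by
  have h1 : |η - a| ≤ a * (1 - a) / 2 := (Set.abs_sub_left_of_mem_uIcc hη).trans hab
  rw [abs_le] at h1
  have h2 : a / 2 ≤ η := by nlinarith
  have h3 : (1 - a) / 2 ≤ 1 - η := by nlinarith
  refine ⟨by linarith, by linarith, ?_⟩
  have := mul_le_mul h2 h3 (by linarith) (by linarith)
  linarith

/-- Quadratic remainder bound for the first-order expansion of `C` at `u`, with the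
coordinates outside `J` treated by the Lipschitz property. -/
lemma abs_taylor_remainder_le {C : (Fin d → ℝ) → ℝ}
    (hder : ∀ j : Fin d, ∀ u ∈ VV d j,
      HasDerivAt (fun t => C (Function.update u j t)) (Cdot C j u) (u j))
    {Cdd : Fin d → Fin d → (Fin d → ℝ) → ℝ}
    (hder2 : ∀ j₁ j₂ : Fin d, ∀ u ∈ VV d j₁ ∩ VV d j₂,
      HasDerivAt (fun t => Cdot C j₂ (Function.update u j₁ t)) (Cdd j₁ j₂ u) (u j₁))
    {K : ℝ} (hK : 0 < K)
    (hbound : ∀ j₁ j₂ : Fin d, ∀ u ∈ VV d j₁ ∩ VV d j₂,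
      |Cdd j₁ j₂ u| ≤ K * min (1 / (u j₁ * (1 - u j₁))) (1 / (u j₂ * (1 - u j₂))))
    (hlip : ∀ p j t, |C p - C (Function.update p j t)| ≤ |p j - t|)
    (hdot : ∀ j u, |Cdot C j u| ≤ 1)
    {u v : Fin d → ℝ} (hu : ∀ j, 0 ≤ u j ∧ u j ≤ 1) (J : Finset (Fin d))
    (hJ : ∀ j ∈ J, 0 < u j ∧ u j < 1 ∧ |v j - u j| ≤ u j * (1 - u j) / 2) :
    |C v - C u - ∑ j, Cdot C j u * (v j - u j)| ≤
      ∑ j ∈ Jᶜ, 2 * |v j - u j| +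
        8 * K * d * ∑ j ∈ J, |v j - u j| ^ 2 / (u j * (1 - u j)) := by
  set f : (Fin d → ℝ) → ℝ := fun p => C p - ∑ j, Cdot C j u * p j with hf
  set z : Fin d → ℝ := J.piecewise v u with hz
  have hupd : ∀ (p : Fin d → ℝ) (k : Fin d) (t : ℝ),
      f p - f (Function.update p k t) =
        C p - C (Function.update p k t) - Cdot C k u * (p k - t) := by
    intro p k t
    have h1 : ∑ j, Cdot C j u * p j - ∑ j, Cdot C j u * Function.update p k t j =
        Cdot C k u * (p k - t) := by
      rw [← Finset.sum_sub_distrib, Finset.sum_eq_single k]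
      · simp; ring
      · intro j _ hj; simp [Function.update_of_ne hj]
      · simp
    simp only [hf]; linarith
  have hvz : |f v - f z| ≤ ∑ j ∈ Jᶜ, 2 * |v j - u j| := by
    refine abs_sub_le_sum_of_step f z v _ Jᶜ ?_ ?_
    · intro k hk p hp
      have hzk : z k = u k := by simp [hz, Finset.mem_compl.1 hk]
      have h1 : |p k - u k| ≤ |v k - u k| := by
        have := Set.abs_sub_left_of_mem_uIcc (hp k)
        rwa [hzk] at this
      rw [hupd, hzk]
      have h2 := hlip p k (u k)
      have h3 : |Cdot C k u * (p k - u k)| ≤ |p k - u k| := by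
        rw [abs_mul]
        exact mul_le_of_le_one_left (abs_nonneg _) (hdot k u)
      have h4 := abs_sub (C p - C (Function.update p k (u k))) (Cdot C k u * (p k - u k))
      linarith
    · intro k hk
      have : k ∈ J := by simpa using hk
      simp [hz, this]
  have hbox : ∀ p : Fin d → ℝ, (∀ i, p i ∈ Set.uIcc (u i) (z i)) →
      (∀ i, 0 ≤ p i ∧ p i ≤ 1) ∧
      ∀ k ∈ J, p ∈ VV d k ∧ u k * (1 - u k) / 4 ≤ p k * (1 - p k) ∧
        |p k - u k| ≤ |v k - u k| := by
    intro p hp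
    have hJp : ∀ k ∈ J, p k ∈ Set.uIcc (u k) (v k) := by
      intro k hk
      have := hp k
      simpa [hz, hk] using this
    have h01 : ∀ i, 0 ≤ p i ∧ p i ≤ 1 := by
      intro i
      by_cases hi : i ∈ J
      · obtain ⟨a, b, c⟩ := hJ i hi
        have := mem_uIcc_bounds a b c (hJp i hi)
        exact ⟨this.1.le, this.2.1.le⟩
      · have := hp i
        simp only [hz, hi, not_false_eq_true, Finset.piecewise_eq_of_notMem, Set.uIcc_self,
          Set.mem_singleton_iff] at this
        rw [this]; exact hu i
    refine ⟨h01, fun k hk => ?_⟩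
    obtain ⟨a, b, c⟩ := hJ k hk
    have := mem_uIcc_bounds a b c (hJp k hk)
    exact ⟨⟨h01, this.1, this.2.1⟩, this.2.2, Set.abs_sub_left_of_mem_uIcc (hJp k hk)⟩
  have hupdbox : ∀ p : Fin d → ℝ, (∀ i, p i ∈ Set.uIcc (u i) (z i)) → ∀ k t,
      t ∈ Set.uIcc (p k) (u k) → ∀ i, Function.update p k t i ∈ Set.uIcc (u i) (z i) := by
    intro p hp k t ht i
    by_cases hi : i = k
    · subst hi
      simp only [Function.update_self]
      exact Set.uIcc_subset_uIcc (hp i) Set.left_mem_uIcc ht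
    · rw [Function.update_of_ne hi]; exact hp i
  set m : Fin d → Fin d → ℝ := fun k j =>
    4 * K * min (1 / (u k * (1 - u k))) (1 / (u j * (1 - u j))) with hm
  have hdotdiff : ∀ j ∈ J, ∀ p : Fin d → ℝ, (∀ i, p i ∈ Set.uIcc (u i) (z i)) →
      |Cdot C j p - Cdot C j u| ≤ ∑ k ∈ J, m k j * |v k - u k| := by
    intro j hj p hp
    refine abs_sub_le_sum_of_step (Cdot C j) u p _ J ?_ ?_
    · intro k hk q hq
      have hq' : ∀ i, q i ∈ Set.uIcc (u i) (z i) := fun i =>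
        Set.uIcc_subset_uIcc Set.left_mem_uIcc (hp i) (hq i)
      have hmem : ∀ t ∈ Set.uIcc (u k) (q k),
          Function.update q k t ∈ VV d k ∩ VV d j := by
        intro t ht
        have := (hbox _ (hupdbox q hq' k t (Set.uIcc_comm (u k) (q k) ▸ ht))).2
        exact ⟨(this k hk).1, (this j hj).1⟩
      obtain ⟨c, hc, hceq⟩ := exists_sub_eq_mul_of_hasDerivAt
        (f := fun t => Cdot C j (Function.update q k t))
        (f' := fun t => Cdd k j (Function.update q k t)) (a := u k) (b := q k) (by
          intro t ht
          have := hder2 k j _ (hmem t ht)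
          simpa using this)
      simp only [Function.update_eq_self] at hceq
      rw [hceq, abs_mul]
      have hbx := hbox _ (hupdbox q hq' k c (Set.uIcc_comm (u k) (q k) ▸ hc))
      refine mul_le_mul ((hbound k j _ (hmem c hc)).trans ?_) ((hbox q hq').2 k hk).2.2
        (abs_nonneg _) ?_
      · have hinv : ∀ i ∈ J, 1 / (Function.update q k c i * (1 - Function.update q k c i)) ≤
            4 * (1 / (u i * (1 - u i))) := by
          intro i hi
          obtain ⟨a, b, -⟩ := hJ i hi
          have h5 : 0 < u i * (1 - u i) := mul_pos a (by linarith)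
          have h6 := (hbx.2 i hi).2.1
          calc _ ≤ 1 / (u i * (1 - u i) / 4) :=
                one_div_le_one_div_of_le (by linarith) h6
            _ = _ := by field_simp
        simp only [hm]
        rw [mul_comm 4 K, mul_assoc]
        refine mul_le_mul_of_nonneg_left ?_ hK.le
        rw [mul_min_of_nonneg _ _ (by norm_num : (0:ℝ) ≤ 4)]
        exact min_le_min (hinv k hk) (hinv j hj)
      · have hpos : ∀ i ∈ J, 0 ≤ 1 / (u i * (1 - u i)) := by
          intro i hi
          obtain ⟨a, b, -⟩ := hJ i hi
          exact one_div_nonneg.2 (mul_nonneg a.le (by linarith))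
        exact mul_nonneg (by linarith) (le_min (hpos k hk) (hpos j hj))
    · intro k hk
      have := hp k
      simpa [hz, hk] using this
  have hzu : |f z - f u| ≤ ∑ j ∈ J, (∑ k ∈ J, m k j * |v k - u k|) * |v j - u j| := by
    refine abs_sub_le_sum_of_step f u z _ J ?_ ?_
    · intro j hj p hp
      obtain ⟨c, hc, hceq⟩ := exists_sub_eq_mul_of_hasDerivAt
        (f := fun t => C (Function.update p j t))
        (f' := fun t => Cdot C j (Function.update p j t)) (a := u j) (b := p j) (by
          intro t ht
          have := hder j _ ((hbox _ (hupdbox p hp j t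
            (Set.uIcc_comm (u j) (p j) ▸ ht))).2 j hj).1
          simpa using this)
      simp only [Function.update_eq_self] at hceq
      rw [hupd, hceq, ← sub_mul, abs_mul]
      exact mul_le_mul (hdotdiff j hj _ (hupdbox p hp j c (Set.uIcc_comm (u j) (p j) ▸ hc)))
        ((hbox p hp).2 j hj).2.2 (abs_nonneg _)
        ((abs_nonneg _).trans (hdotdiff j hj p hp))
    · intro k hk; simp [hz, hk]
  have hsum : ∑ j ∈ J, (∑ k ∈ J, m k j * |v k - u k|) * |v j - u j| ≤
      8 * K * d * ∑ j ∈ J, |v j - u j| ^ 2 / (u j * (1 - u j)) := by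
    set r : Fin d → ℝ := fun j => |v j - u j| ^ 2 / (u j * (1 - u j)) with hr
    have hr0 : ∀ j ∈ J, 0 ≤ r j := by
      intro j hj
      obtain ⟨a, b, -⟩ := hJ j hj
      exact div_nonneg (sq_nonneg _) (mul_nonneg a.le (by linarith))
    have hterm : ∀ j ∈ J, ∀ k ∈ J,
        m k j * |v k - u k| * |v j - u j| ≤ 4 * K * (r k + r j) := by
      intro j hj k hk
      set μ := min (1 / (u k * (1 - u k))) (1 / (u j * (1 - u j))) with hμ
      have hμ0 : 0 ≤ μ := by
        obtain ⟨a, b, -⟩ := hJ j hj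
        obtain ⟨a', b', -⟩ := hJ k hk
        exact le_min (one_div_nonneg.2 (mul_nonneg a'.le (by linarith)))
          (one_div_nonneg.2 (mul_nonneg a.le (by linarith)))
      have h1 : μ * |v k - u k| ^ 2 ≤ r k := by
        rw [hr]; simp only; rw [div_eq_mul_one_div, mul_comm]
        exact mul_le_mul_of_nonneg_left (min_le_left _ _) (sq_nonneg _)
      have h2 : μ * |v j - u j| ^ 2 ≤ r j := by
        rw [hr]; simp only; rw [div_eq_mul_one_div, mul_comm]
        exact mul_le_mul_of_nonneg_left (min_le_right _ _) (sq_nonneg _)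
      have h3 : |v k - u k| * |v j - u j| ≤ |v k - u k| ^ 2 + |v j - u j| ^ 2 := by
        nlinarith [sq_nonneg (|v k - u k| - |v j - u j|), sq_nonneg (|v k - u k|),
          sq_nonneg (|v j - u j|)]
      have h4 := mul_le_mul_of_nonneg_left h3 hμ0
      have h5 : μ * (|v k - u k| * |v j - u j|) ≤ r k + r j := by linarith
      have h6 := mul_le_mul_of_nonneg_left h5 (by linarith : 0 ≤ 4 * K)
      simp only [hm]
      linarith
    have hcard : (J.card : ℝ) ≤ d := by
      have := Finset.card_le_univ J
      simp only [Fintype.card_fin] at this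
      exact_mod_cast this
    have hS0 : 0 ≤ ∑ j ∈ J, r j := Finset.sum_nonneg hr0
    calc _ = ∑ j ∈ J, ∑ k ∈ J, m k j * |v k - u k| * |v j - u j| :=
          Finset.sum_congr rfl fun j _ => Finset.sum_mul _ _ _
      _ ≤ ∑ j ∈ J, ∑ k ∈ J, 4 * K * (r k + r j) :=
          Finset.sum_le_sum fun j hj => Finset.sum_le_sum fun k hk => hterm j hj k hk
      _ = 8 * K * J.card * ∑ j ∈ J, r j := by
          simp only [← Finset.mul_sum, Finset.sum_add_distrib, Finset.sum_const, nsmul_eq_mul]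
          ring
      _ ≤ _ := by
          refine mul_le_mul_of_nonneg_right ?_ hS0
          exact mul_le_mul_of_nonneg_left hcard (by linarith)
  have hfin : C v - C u - ∑ j, Cdot C j u * (v j - u j) = (f v - f z) + (f z - f u) := by
    simp only [hf, mul_sub, Finset.sum_sub_distrib]; ring
  rw [hfin]
  exact (abs_add_le _ _).trans (add_le_add hvz (hzu.trans hsum))

section Marginal

variable {P : Measure Ω} {X : ℤ → Ω → Fin d → ℝ}

lemma margF_nonneg (j : Fin d) (x : ℝ) : 0 ≤ margF P X j x := ENNReal.toReal_nonneg

lemma Uv_nonneg (i : ℤ) (ω : Ω) (j : Fin d) : 0 ≤ Uv P X i ω j := margF_nonneg j _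

lemma measurable_Uv (hmeas : ∀ i, Measurable (X i)) {j : Fin d}
    (hcont : Continuous (margF P X j)) (i : ℤ) : Measurable fun ω => Uv P X i ω j :=
  hcont.measurable.comp ((measurable_pi_apply j).comp (hmeas i))

variable [IsProbabilityMeasure P]


lemma margF_le_one (j : Fin d) (x : ℝ) : margF P X j x ≤ 1 :=
  measureReal_le_one (μ := P)

lemma Uv_le_one (i : ℤ) (ω : Ω) (j : Fin d) : Uv P X i ω j ≤ 1 := margF_le_one j _

lemma margF_mono (j : Fin d) : Monotone (margF P X j) := fun _ _ h =>
  measureReal_mono (μ := P) fun _ hω => le_trans hω h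

lemma margF_eq_cdf (hmeas : Measurable (X 0)) (j : Fin d) (x : ℝ) :
    margF P X j x = ProbabilityTheory.cdf (P.map fun ω => X 0 ω j) x := by
  have hY : Measurable fun ω => X 0 ω j := (measurable_pi_apply j).comp hmeas
  have := Measure.isProbabilityMeasure_map (μ := P) hY.aemeasurable
  rw [ProbabilityTheory.cdf_eq_real, map_measureReal_apply hY measurableSet_Iic]
  rfl

lemma exists_margF_eq (hmeas : Measurable (X 0)) {j : Fin d} (hcont : Continuous (margF P X j))
    {s : ℝ} (hs : s ∈ Set.Ioo (0 : ℝ) 1) : ∃ x, margF P X j x = s := by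
  have hY : Measurable fun ω => X 0 ω j := (measurable_pi_apply j).comp hmeas
  have := Measure.isProbabilityMeasure_map (μ := P) hY.aemeasurable
  have heq : margF P X j = ProbabilityTheory.cdf (P.map fun ω => X 0 ω j) :=
    funext (margF_eq_cdf hmeas j)
  have h0 : Tendsto (margF P X j) atBot (nhds 0) := by
    rw [heq]; exact ProbabilityTheory.tendsto_cdf_atBot _
  have h1 : Tendsto (margF P X j) atTop (nhds 1) := by
    rw [heq]; exact ProbabilityTheory.tendsto_cdf_atTop _
  obtain ⟨a, ha⟩ := (h0.eventually_lt_const hs.1).exists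
  obtain ⟨b, hb⟩ := (h1.eventually_const_lt hs.2).exists
  exact mem_range_of_exists_le_of_exists_ge hcont ⟨a, ha.le⟩ ⟨b, hb.le⟩

/-- The probability integral transform: `U_{0j}` is uniform on `[0,1]`. -/
lemma measureReal_Uv_le (hmeas : Measurable (X 0)) {j : Fin d}
    (hcont : Continuous (margF P X j)) {s : ℝ} (hs : s ∈ Set.Icc (0 : ℝ) 1) :
    P.real {ω | Uv P X 0 ω j ≤ s} = s := by
  have hupper : ∀ s' ∈ Set.Ioo (0 : ℝ) 1, ∀ s < s', P.real {ω | Uv P X 0 ω j ≤ s} ≤ s' := by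
    intro s' hs' s hss
    obtain ⟨x, hx⟩ := exists_margF_eq hmeas hcont hs'
    rw [← hx]
    refine measureReal_mono fun ω hω => ?_
    by_contra hlt
    have h1 : margF P X j x ≤ Uv P X 0 ω j := margF_mono j (not_le.1 hlt).le
    have h2 : Uv P X 0 ω j ≤ s := hω
    linarith
  rcases hs.2.eq_or_lt with rfl | h1
  · have : {ω | Uv P X 0 ω j ≤ 1} = Set.univ := Set.eq_univ_of_forall fun ω => Uv_le_one 0 ω j
    rw [this]; simp
  refine le_antisymm ?_ ?_
  · refine le_of_forall_gt_imp_ge_of_dense fun s' hs' => ?_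
    rcases lt_or_ge s' 1 with h | h
    · exact hupper s' ⟨hs.1.trans_lt hs', h⟩ s hs'
    · exact measureReal_le_one.trans h
  · rcases hs.1.eq_or_lt with rfl | h0
    · exact measureReal_nonneg
    · obtain ⟨x, hx⟩ := exists_margF_eq hmeas hcont ⟨h0, h1⟩
      calc s = margF P X j x := hx.symm
        _ ≤ _ := measureReal_mono (μ := P) fun ω hω => by
          change margF P X j (X 0 ω j) ≤ s
          rw [← hx]; exact margF_mono j hω

lemma measureReal_Uv_le_sub_le (hmeas : Measurable (X 0)) {j : Fin d}
    (hcont : Continuous (margF P X j)) {s t : ℝ} (hst : s ≤ t) :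
    P.real {ω | Uv P X 0 ω j ≤ t} - P.real {ω | Uv P X 0 ω j ≤ s} ≤ t - s := by
  have hneg : ∀ s : ℝ, s < 0 → P.real {ω | Uv P X 0 ω j ≤ s} = 0 := by
    intro s hs
    have : {ω | Uv P X 0 ω j ≤ s} = ∅ := Set.eq_empty_of_forall_notMem fun ω hω =>
      absurd (Uv_nonneg (P := P) (X := X) 0 ω j) (not_le.2 (lt_of_le_of_lt hω hs))
    rw [this]; simp
  have hbig : ∀ s : ℝ, 1 ≤ s → P.real {ω | Uv P X 0 ω j ≤ s} = 1 := by
    intro s hs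
    have : {ω | Uv P X 0 ω j ≤ s} = Set.univ :=
      Set.eq_univ_of_forall fun ω => (Uv_le_one 0 ω j).trans hs
    rw [this]; simp
  have hmid : ∀ s : ℝ, 0 ≤ s → s ≤ 1 → P.real {ω | Uv P X 0 ω j ≤ s} = s := fun s h0 h1 =>
    measureReal_Uv_le hmeas hcont ⟨h0, h1⟩
  rcases lt_or_ge s 0 with h1 | h1 <;> rcases lt_or_ge t 0 with h2 | h2 <;>
    rcases le_or_gt 1 s with h3 | h3 <;> rcases le_or_gt 1 t with h4 | h4 <;>
    first
    | linarith
    | (rw [hneg s h1, hneg t h2]; linarith)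
    | (rw [hneg s h1, hbig t h4]; linarith)
    | (rw [hneg s h1, hmid t h2 h4.le]; linarith)
    | (rw [hbig s h3, hbig t h4]; linarith)
    | (rw [hmid s h1 h3.le, hbig t h4]; linarith)
    | (rw [hmid s h1 h3.le, hmid t h2 h4.le])

lemma cop_update_sub_mem (hmeas : ∀ i, Measurable (X i)) (hcont : ∀ j, Continuous (margF P X j))
    (p : Fin d → ℝ) (j : Fin d) {s t : ℝ} (hst : s ≤ t) :
    cop P X (Function.update p j t) - cop P X (Function.update p j s) ∈ Set.Icc 0 (t - s) := by
  have hms : MeasurableSet {ω | Uv P X 0 ω j ≤ s} :=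
    measurableSet_le (measurable_Uv hmeas (hcont j) 0) measurable_const
  have hle : ∀ k, Function.update p j s k ≤ Function.update p j t k := fun k =>
    update_le_update_iff.2 ⟨hst, fun _ _ => le_rfl⟩ k
  have hmono : cop P X (Function.update p j s) ≤ cop P X (Function.update p j t) :=
    measureReal_mono (μ := P) fun ω hω k => (hω k).trans (hle k)
  have hsub : cop P X (Function.update p j t) ≤ cop P X (Function.update p j s) +
      P.real ({ω | Uv P X 0 ω j ≤ t} \ {ω | Uv P X 0 ω j ≤ s}) := by
    refine le_trans (measureReal_mono (μ := P) fun ω hω => ?_) (measureReal_union_le _ _)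
    by_cases h : Uv P X 0 ω j ≤ s
    · refine Or.inl fun k => ?_
      by_cases hk : k = j
      · subst hk; simpa using h
      · have := hω k
        rwa [Function.update_of_ne hk] at this ⊢
    · refine Or.inr ⟨?_, h⟩
      have := hω j
      simpa using this
  have hdiff : P.real ({ω | Uv P X 0 ω j ≤ t} \ {ω | Uv P X 0 ω j ≤ s}) =
      P.real {ω | Uv P X 0 ω j ≤ t} - P.real {ω | Uv P X 0 ω j ≤ s} :=
    measureReal_sdiff (fun ω hω => le_trans hω hst) hms
  have := measureReal_Uv_le_sub_le (P := P) (hmeas 0) (hcont j) hst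
  exact ⟨by linarith, by linarith⟩

lemma abs_cop_sub_update_le (hmeas : ∀ i, Measurable (X i))
    (hcont : ∀ j, Continuous (margF P X j)) (p : Fin d → ℝ) (j : Fin d) (t : ℝ) :
    |cop P X p - cop P X (Function.update p j t)| ≤ |p j - t| := by
  rcases le_total (p j) t with h | h
  · have := cop_update_sub_mem (P := P) hmeas hcont p j h
    rw [Function.update_eq_self] at this
    rw [abs_sub_comm, abs_of_nonneg this.1, abs_sub_comm, abs_of_nonneg (sub_nonneg.2 h)]
    exact this.2
  · have := cop_update_sub_mem (P := P) hmeas hcont p j h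
    rw [Function.update_eq_self] at this
    rw [abs_of_nonneg this.1, abs_of_nonneg (sub_nonneg.2 h)]
    exact this.2

lemma abs_Cdot_cop_le_one (hmeas : ∀ i, Measurable (X i))
    (hcont : ∀ j, Continuous (margF P X j)) (j : Fin d) (u : Fin d → ℝ) :
    |Cdot (cop P X) j u| ≤ 1 := by
  have hq : ∀ h : ℝ,
      |(cop P X (Function.update u j (u j + h)) - cop P X u) / h| ≤ 1 := by
    intro h
    have := abs_cop_sub_update_le (P := P) hmeas hcont u j (u j + h)
    rw [abs_div, abs_sub_comm (cop P X _)]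
    refine div_le_one_of_le₀ (this.trans_eq ?_) (abs_nonneg _)
    simp
  have hle : ∀ᶠ h in nhdsWithin (0 : ℝ) {(0 : ℝ)}ᶜ,
      (cop P X (Function.update u j (u j + h)) - cop P X u) / h ≤ 1 :=
    Eventually.of_forall fun h => (abs_le.1 (hq h)).2
  have hge : ∀ᶠ h in nhdsWithin (0 : ℝ) {(0 : ℝ)}ᶜ,
      -1 ≤ (cop P X (Function.update u j (u j + h)) - cop P X u) / h :=
    Eventually.of_forall fun h => (abs_le.1 (hq h)).1
  refine abs_le.2 ⟨?_, ?_⟩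
  · refine le_limsup_of_le ⟨1, hle⟩ fun b hb => ?_
    obtain ⟨h, h1, h2⟩ := (hb.and hge).exists
    exact h2.trans h1
  · exact limsup_le_of_le (IsBoundedUnder.isCoboundedUnder_le ⟨-1, hge⟩) hle

lemma cop_update_one (hmeas : ∀ i, Measurable (X i)) (hcont : ∀ j, Continuous (margF P X j))
    (j : Fin d) {s : ℝ} (hs : s ∈ Set.Icc (0 : ℝ) 1) :
    cop P X (Function.update (fun _ => (1 : ℝ)) j s) = s := by
  refine Eq.trans (congrArg P.real (Set.ext fun ω => ?_))
    (measureReal_Uv_le (P := P) (hmeas 0) (hcont j) hs)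
  refine ⟨fun h => by simpa using h j, fun h k => ?_⟩
  by_cases hk : k = j
  · subst hk; simpa using h
  · rw [Function.update_of_ne hk]; exact Uv_le_one 0 ω k

lemma ae_Uv_mem_Ioo (hmeas : ∀ i, Measurable (X i)) (hstat : StrictlyStationary P X)
    (hcont : ∀ j, Continuous (margF P X j)) :
    ∀ᵐ ω ∂P, ∀ (i : ℤ) (j : Fin d), Uv P X i ω j ∈ Set.Ioo (0 : ℝ) 1 := by
  rw [ae_all_iff]; intro i
  rw [ae_all_iff]; intro j
  have hmap : P.map (X i) = P.map (X 0) := by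
    have h := hstat 1 (fun _ => 0) i
    have hm : ∀ k : ℤ, Measurable fun (ω : Ω) (_ : Fin 1) => X k ω := fun k =>
      measurable_pi_lambda _ fun _ => hmeas k
    have h' := congrArg (Measure.map fun q : Fin 1 → Fin d → ℝ => q 0) h
    rw [Measure.map_map (measurable_pi_apply 0) (hm _),
      Measure.map_map (measurable_pi_apply 0) (hm _)] at h'
    simpa [Function.comp_def] using h'
  have hzero : ∀ᵐ ω ∂P, Uv P X 0 ω j ∈ Set.Ioo (0 : ℝ) 1 := by
    have hms : ∀ s, MeasurableSet {ω | Uv P X 0 ω j ≤ s} := fun s =>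
      measurableSet_le (measurable_Uv hmeas (hcont j) 0) measurable_const
    have h0 : ∀ᵐ ω ∂P, ¬ Uv P X 0 ω j ≤ 0 := by
      rw [ae_iff]
      have := measureReal_Uv_le (P := P) (hmeas 0) (hcont j) (s := 0) (by simp)
      simpa using (measureReal_eq_zero_iff (μ := P)).1 this
    have h1 : ∀ᵐ ω ∂P, Uv P X 0 ω j < 1 := by
      rw [ae_iff, ← measureReal_eq_zero_iff (μ := P)]
      refine le_antisymm (le_of_forall_gt_imp_ge_of_dense fun ε hε => ?_) measureReal_nonneg
      rcases le_or_gt 1 ε with h | h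
      · exact measureReal_le_one.trans h
      have h2 := measureReal_Uv_le (P := P) (hmeas 0) (hcont j) (s := 1 - ε)
        ⟨by linarith, by linarith⟩
      have h3 : P.real {ω | Uv P X 0 ω j ≤ 1 - ε}ᶜ = ε := by
        rw [measureReal_compl (hms _), h2]; simp
      rw [← h3]
      refine measureReal_mono fun ω hω hle => hω ?_
      have : Uv P X 0 ω j ≤ 1 - ε := hle
      linarith
    filter_upwards [h0, h1] with ω h2 h3 using ⟨not_le.1 h2, h3⟩
  have hset : MeasurableSet {x : Fin d → ℝ | margF P X j (x j) ∈ Set.Ioo (0 : ℝ) 1} :=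
    ((hcont j).measurable.comp (measurable_pi_apply j)) measurableSet_Ioo
  have h4 : ∀ᵐ x ∂(P.map (X 0)), margF P X j (x j) ∈ Set.Ioo (0 : ℝ) 1 :=
    (ae_map_iff (hmeas 0).aemeasurable hset).2 hzero
  rw [← hmap] at h4
  exact (ae_map_iff (hmeas i).aemeasurable hset).1 h4

end Marginal

section Empirical

variable {P : Measure Ω} {X : ℤ → Ω → Fin d → ℝ}

lemma indic_mem {α : Type*} (s : Set α) (x : α) : 0 ≤ indic s x ∧ indic s x ≤ 1 := by
  unfold indic
  by_cases h : x ∈ s <;> simp [h]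

lemma indic_le_indic {α : Type*} {s t : Set α} {x : α} (h : x ∈ s → x ∈ t) :
    indic s x ≤ indic t x := by
  unfold indic
  by_cases hs : x ∈ s
  · simp [hs, h hs]
  · by_cases ht : x ∈ t <;> simp [hs, ht]

lemma average_mem {n : ℕ} {f : ℤ → ℝ} (hf : ∀ i, 0 ≤ f i ∧ f i ≤ 1) :
    0 ≤ (n : ℝ)⁻¹ * ∑ i ∈ Finset.Icc (1 : ℤ) (n : ℤ), f i ∧
      (n : ℝ)⁻¹ * ∑ i ∈ Finset.Icc (1 : ℤ) (n : ℤ), f i ≤ 1 := by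
  refine ⟨mul_nonneg (by positivity) (Finset.sum_nonneg fun i _ => (hf i).1), ?_⟩
  have h1 : ∑ i ∈ Finset.Icc (1 : ℤ) (n : ℤ), f i ≤ n := by
    refine (Finset.sum_le_sum fun i _ => (hf i).2).trans ?_
    simp
  rw [inv_mul_eq_div]
  exact div_le_one_of_le₀ h1 (by positivity)

lemma Gn_update_one (n : ℕ) (j : Fin d) (s : ℝ) (ω : Ω) [IsProbabilityMeasure P] :
    Gn P X n (Function.update (fun _ => (1 : ℝ)) j s) ω = Gnj P X n j s ω := by
  have hset : ∀ i, {ω' | ∀ k, Uv P X i ω' k ≤ Function.update (fun _ => (1 : ℝ)) j s k} =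
      {ω' | Uv P X i ω' j ≤ s} := by
    intro i
    ext ω'
    refine ⟨fun h => by simpa using h j, fun h k => ?_⟩
    by_cases hk : k = j
    · subst hk; simpa using h
    · rw [Function.update_of_ne hk]; exact Uv_le_one i ω' k
  simp only [Gn, Gnj, hset]

lemma abs_alphan_le [IsProbabilityMeasure P] (n : ℕ) (u : Fin d → ℝ) (ω : Ω) :
    |alphan P X n u ω| ≤ Real.sqrt n := by
  have h1 : 0 ≤ Gn P X n u ω ∧ Gn P X n u ω ≤ 1 := average_mem fun i => indic_mem _ _
  have h2 : 0 ≤ cop P X u := measureReal_nonneg (μ := P)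
  have h3 : cop P X u ≤ 1 := measureReal_le_one (μ := P)
  rw [alphan, abs_mul, abs_of_nonneg (Real.sqrt_nonneg _)]
  refine mul_le_of_le_one_right (Real.sqrt_nonneg _) (abs_le.2 ⟨?_, ?_⟩) <;> linarith

/-- The generalized inverse of the marginal empirical c.d.f. is one of the observations. -/
lemma exists_genInv_Gnj_eq {n : ℕ} (hn : 1 ≤ n) {ω : Ω} {j : Fin d}
    (hU : ∀ i, Uv P X i ω j ∈ Set.Ioo (0 : ℝ) 1) {s : ℝ} (hs0 : 0 < s) (hs1 : s ≤ 1) :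
    genInv (fun x => Gnj P X n j x ω) s ∈ Set.Ioo (0 : ℝ) 1 ∧
      IsLeast {x | s ≤ Gnj P X n j x ω} (genInv (fun x => Gnj P X n j x ω) s) := by
  have hstep : ∀ y, s ≤ Gnj P X n j y ω → ∃ i ∈ Finset.Icc (1 : ℤ) (n : ℤ),
      Uv P X i ω j ≤ y ∧ s ≤ Gnj P X n j (Uv P X i ω j) ω := by
    intro y hy
    have hne : ((Finset.Icc (1 : ℤ) (n : ℤ)).filter fun i => Uv P X i ω j ≤ y).Nonempty := by
      by_contra hem
      rw [Finset.not_nonempty_iff_eq_empty, Finset.filter_eq_empty_iff] at hem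
      have : Gnj P X n j y ω = 0 := by
        rw [Gnj, Finset.sum_eq_zero, mul_zero]
        intro i hi
        simp [indic, hem hi]
      linarith
    obtain ⟨i, hi, hmax⟩ := Finset.exists_max_image _ (fun i => Uv P X i ω j) hne
    rw [Finset.mem_filter] at hi
    refine ⟨i, hi.1, hi.2, hy.trans ?_⟩
    refine mul_le_mul_of_nonneg_left (Finset.sum_le_sum fun k hk => ?_) (by positivity)
    exact indic_le_indic fun hky => hmax k (Finset.mem_filter.2 ⟨hk, hky⟩)
  have hone : s ≤ Gnj P X n j 1 ω := by
    refine hs1.trans_eq ?_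
    have : ∀ i, indic {ω' | Uv P X i ω' j ≤ 1} ω = 1 := fun i => by
      simp [indic, (hU i).2.le]
    have hn' : (n : ℝ) ≠ 0 := by positivity
    simp [Gnj, this, hn']
  obtain ⟨i₀, hi₀, -, hi₀s⟩ := hstep 1 hone
  obtain ⟨i, hi, hmin⟩ := Finset.exists_min_image
    ((Finset.Icc (1 : ℤ) (n : ℤ)).filter fun i => s ≤ Gnj P X n j (Uv P X i ω j) ω)
    (fun i => Uv P X i ω j) ⟨i₀, Finset.mem_filter.2 ⟨hi₀, hi₀s⟩⟩
  have hleast : IsLeast {x | s ≤ Gnj P X n j x ω} (Uv P X i ω j) := by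
    refine ⟨(Finset.mem_filter.1 hi).2, fun y hy => ?_⟩
    obtain ⟨k, hk, hky, hks⟩ := hstep y hy
    exact (hmin k (Finset.mem_filter.2 ⟨hk, hks⟩)).trans hky
  have heq : genInv (fun x => Gnj P X n j x ω) s = Uv P X i ω j := by
    rw [genInv, if_neg hs0.ne']
    exact hleast.csInf_eq
  rw [heq]
  exact ⟨hU i, hleast⟩

/-- Bounds on the distance between the empirical quantile function and the identity. -/
lemma abs_genInv_sub_le {n : ℕ} (hn : 1 ≤ n) {ω : Ω} {j : Fin d}
    (hU : ∀ i, Uv P X i ω j ∈ Set.Ioo (0 : ℝ) 1) {B w w' : ℝ} (hB0 : 0 ≤ B)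
    (hw0 : 0 < w) (hww' : w ≤ (1 / 2 + w) * w') (hw'1 : w' ≤ 1)
    (hB : ∀ s ∈ Set.Ioo ((n : ℝ) ^ (-(1 / 2 + w))) (1 - (n : ℝ) ^ (-(1 / 2 + w))),
      |betanj P X n j s ω| ≤ B * (s * (1 - s)) ^ w')
    (hn3 : 3 * (n : ℝ) ^ (-(1 / 2 + w)) < 1) {s : ℝ} (hs : (n : ℝ) ^ (-(1 / 2 : ℝ)) < s)
    (hs1 : s ≤ 1) :
    (s ≤ 1 - 2 * (n : ℝ) ^ (-(1 / 2 + w)) →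
      |genInv (fun x => Gnj P X n j x ω) s - s| ≤
        B * (n : ℝ) ^ (-(1 / 2 : ℝ)) * (s * (1 - s)) ^ w') ∧
    (1 - 2 * (n : ℝ) ^ (-(1 / 2 + w)) < s →
      |genInv (fun x => Gnj P X n j x ω) s - s| ≤
        (2 + 2 * B) * (n : ℝ) ^ (-(1 / 2 + w))) := by
  have hN1 : (1 : ℝ) ≤ n := by exact_mod_cast hn
  have hN : (0 : ℝ) < n := by linarith
  have hlam : (0 : ℝ) < (n : ℝ) ^ (-(1 / 2 + w)) := Real.rpow_pos_of_pos hN _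
  have hw'0 : 0 < w' := by
    by_contra h
    have : (1 / 2 + w) * w' ≤ 0 := mul_nonpos_of_nonneg_of_nonpos (by linarith) (not_lt.1 h)
    linarith
  have hle : (n : ℝ) ^ (-(1 / 2 + w)) ≤ (n : ℝ) ^ (-(1 / 2 : ℝ)) :=
    Real.rpow_le_rpow_of_exponent_le hN1 (by linarith)
  have hsqrt : Real.sqrt n * (n : ℝ) ^ (-(1 / 2 : ℝ)) = 1 := by
    rw [Real.sqrt_eq_rpow, ← Real.rpow_add hN]; norm_num
  have hsqpos : 0 < Real.sqrt n := Real.sqrt_pos.2 hN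
  have hgood : ∀ t ∈ Set.Ioo ((n : ℝ) ^ (-(1 / 2 + w))) (1 - (n : ℝ) ^ (-(1 / 2 + w))),
      |genInv (fun x => Gnj P X n j x ω) t - t| ≤
        B * (n : ℝ) ^ (-(1 / 2 : ℝ)) * (t * (1 - t)) ^ w' := by
    intro t ht
    have h1 := hB t ht
    rw [betanj, abs_mul, abs_of_pos hsqpos] at h1
    refine le_of_mul_le_mul_left (h1.trans_eq ?_) hsqpos
    linear_combination -(B * (t * (1 - t)) ^ w') * hsqrt
  refine ⟨fun h => hgood s ⟨hle.trans_lt hs, by linarith⟩, fun h => ?_⟩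
  have hs0 : 0 < s := hlam.trans_le (hle.trans hs.le)
  set q : ℝ := (n : ℝ) ^ (-(1 / 2 + w)) with hq
  have ht : 1 - 2 * q ∈ Set.Ioo q (1 - q) := ⟨by linarith, by linarith⟩
  have h1 := hgood _ ht
  obtain ⟨hvs, hleasts⟩ := exists_genInv_Gnj_eq hn hU hs0 hs1
  obtain ⟨-, hleastt⟩ := exists_genInv_Gnj_eq (s := 1 - 2 * q) hn hU (by linarith) (by linarith)
  have hmono := hleastt.2 (show 1 - 2 * q ≤ _ from h.le.trans hleasts.1)
  have h2 : ((1 - 2 * q) * (1 - (1 - 2 * q))) ^ w' ≤ 2 * (n : ℝ) ^ (-w) := by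
    calc ((1 - 2 * q) * (1 - (1 - 2 * q))) ^ w' ≤ (2 * q) ^ w' :=
          Real.rpow_le_rpow (by nlinarith) (by nlinarith) hw'0.le
      _ = 2 ^ w' * q ^ w' := Real.mul_rpow (by norm_num) hlam.le
      _ ≤ 2 * (n : ℝ) ^ (-w) := by
          refine mul_le_mul ?_ ?_ (by positivity) (by norm_num)
          · calc (2 : ℝ) ^ w' ≤ 2 ^ (1 : ℝ) :=
                  Real.rpow_le_rpow_of_exponent_le (by norm_num) hw'1
              _ = 2 := Real.rpow_one 2
          · rw [hq, ← Real.rpow_mul hN.le]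
            exact Real.rpow_le_rpow_of_exponent_le hN1 (by linarith)
  have h3 : B * (n : ℝ) ^ (-(1 / 2 : ℝ)) * ((1 - 2 * q) * (1 - (1 - 2 * q))) ^ w' ≤
      2 * B * q := by
    calc _ ≤ B * (n : ℝ) ^ (-(1 / 2 : ℝ)) * (2 * (n : ℝ) ^ (-w)) :=
          mul_le_mul_of_nonneg_left h2 (by positivity)
      _ = 2 * B * ((n : ℝ) ^ (-(1 / 2 : ℝ)) * (n : ℝ) ^ (-w)) := by ring
      _ = 2 * B * q := by
          rw [← Real.rpow_add hN, hq]; congr 2; ring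
  have h4 := (abs_le.1 (h1.trans h3)).1
  have h5 := hvs.2
  have h6 : 0 ≤ B * q := by positivity
  rw [abs_le]
  constructor <;> nlinarith

end Empirical

section Comparison

variable {P : Measure Ω} [IsProbabilityMeasure P] {X : ℤ → Ω → Fin d → ℝ}

/-- `√n (G_{nj}(G_{nj}⁻(s)) − s)` is controlled by the modulus of continuity of `α_n`. -/
lemma sqrt_mul_Gnj_genInv_sub_mem (hmeas : ∀ i, Measurable (X i))
    (hcont : ∀ j, Continuous (margF P X j)) {n : ℕ} (hn : 1 ≤ n) {ω : Ω} {j : Fin d}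
    (hU : ∀ i, Uv P X i ω j ∈ Set.Ioo (0 : ℝ) 1) {M w δ : ℝ} (hM0 : 0 ≤ M) (hw : 0 ≤ w)
    (hM : ∀ p q : Fin d → ℝ, p ∈ Set.Icc 0 1 → q ∈ Set.Icc 0 1 → dist p q ≤ δ →
      |alphan P X n p ω - alphan P X n q ω| ≤ M * max (dist p q ^ w) ((n : ℝ) ^ (-w)))
    (hδ : (n : ℝ)⁻¹ ≤ δ) {s : ℝ} (hs0 : 0 < s) (hs1 : s ≤ 1) :
    0 ≤ Real.sqrt n * (Gnj P X n j (genInv (fun x => Gnj P X n j x ω) s) ω - s) ∧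
    Real.sqrt n * (Gnj P X n j (genInv (fun x => Gnj P X n j x ω) s) ω - s) ≤
      M * (n : ℝ) ^ (-w) + (n : ℝ) ^ (-(1 / 2 : ℝ)) := by
  have hN : (0 : ℝ) < n := by exact_mod_cast hn
  obtain ⟨hv, hleast⟩ := exists_genInv_Gnj_eq hn hU hs0 hs1
  set v := genInv (fun x => Gnj P X n j x ω) s
  have hsv : s ≤ Gnj P X n j v ω := hleast.1
  refine ⟨mul_nonneg (Real.sqrt_nonneg _) (sub_nonneg.2 hsv), ?_⟩
  set y := max 0 (v - (n : ℝ)⁻¹) with hy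
  have hninv : 0 < (n : ℝ)⁻¹ := inv_pos.2 hN
  have hyv : y < v := max_lt hv.1 (by linarith)
  have hy0 : 0 ≤ y := le_max_left _ _
  have hy1 : v - (n : ℝ)⁻¹ ≤ y := le_max_right _ _
  have hGy : Gnj P X n j y ω < s := by
    by_contra h
    exact absurd (hleast.2 (not_lt.1 h)) (not_le.2 hyv)
  have hmem : ∀ t : ℝ, 0 ≤ t → t ≤ 1 →
      Function.update (fun _ => (1 : ℝ)) j t ∈ Set.Icc (0 : Fin d → ℝ) 1 := by
    intro t h0 h1
    refine ⟨fun k => ?_, fun k => ?_⟩ <;> by_cases hk : k = j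
    · subst hk; simpa using h0
    · simp [Function.update_of_ne hk]
    · subst hk; simpa using h1
    · simp [Function.update_of_ne hk]
  have hdist : dist (Function.update (fun _ => (1 : ℝ)) j v)
      (Function.update (fun _ => (1 : ℝ)) j y) ≤ (n : ℝ)⁻¹ := by
    refine (dist_pi_le_iff hninv.le).2 fun k => ?_
    by_cases hk : k = j
    · subst hk
      simp only [Function.update_self, Real.dist_eq]
      rw [abs_of_pos (by linarith)]; linarith
    · simp [Function.update_of_ne hk]
  have h1 := hM _ _ (hmem v hv.1.le hv.2.le) (hmem y hy0 (hyv.le.trans hv.2.le))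
    (hdist.trans hδ)
  have h2 : max (dist (Function.update (fun _ => (1 : ℝ)) j v)
      (Function.update (fun _ => (1 : ℝ)) j y) ^ w) ((n : ℝ) ^ (-w)) ≤ (n : ℝ) ^ (-w) := by
    refine max_le ?_ le_rfl
    rw [Real.rpow_neg hN.le, ← Real.inv_rpow hN.le]
    exact Real.rpow_le_rpow dist_nonneg hdist hw
  have h3 := (le_abs_self _).trans (h1.trans (mul_le_mul_of_nonneg_left h2 hM0))
  rw [alphan, alphan, Gn_update_one, Gn_update_one,
    cop_update_one hmeas hcont j ⟨hv.1.le, hv.2.le⟩,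
    cop_update_one hmeas hcont j ⟨hy0, hyv.le.trans hv.2.le⟩] at h3
  have h4 : Real.sqrt n * (v - y) ≤ (n : ℝ) ^ (-(1 / 2 : ℝ)) := by
    calc Real.sqrt n * (v - y) ≤ Real.sqrt n * (n : ℝ)⁻¹ :=
          mul_le_mul_of_nonneg_left (by linarith) (Real.sqrt_nonneg _)
      _ = (n : ℝ) ^ (-(1 / 2 : ℝ)) := by
          rw [Real.sqrt_eq_rpow, ← Real.rpow_neg_one, ← Real.rpow_add hN]; norm_num
  have h5 : Real.sqrt n * (Gnj P X n j v ω - s) ≤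
      Real.sqrt n * (Gnj P X n j v ω - Gnj P X n j y ω) :=
    mul_le_mul_of_nonneg_left (by linarith) (Real.sqrt_nonneg _)
  linarith

/-- A deterministic bound for the distance between `𝔺_n` and `C̄_n`, on the event that the
modulus of continuity of `α_n` and the weighted quantile processes are controlled. -/
lemma abs_CPgi_sub_Cbar_le (hmeas : ∀ i, Measurable (X i))
    (hcont : ∀ j, Continuous (margF P X j))
    (hder : ∀ j : Fin d, ∀ u ∈ VV d j,
      HasDerivAt (fun t => cop P X (Function.update u j t)) (Cdot (cop P X) j u) (u j))
    {Cdd : Fin d → Fin d → (Fin d → ℝ) → ℝ}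
    (hder2 : ∀ j₁ j₂ : Fin d, ∀ u ∈ VV d j₁ ∩ VV d j₂,
      HasDerivAt (fun t => Cdot (cop P X) j₂ (Function.update u j₁ t)) (Cdd j₁ j₂ u) (u j₁))
    {K : ℝ} (hK : 0 < K)
    (hbound : ∀ j₁ j₂ : Fin d, ∀ u ∈ VV d j₁ ∩ VV d j₂,
      |Cdd j₁ j₂ u| ≤ K * min (1 / (u j₁ * (1 - u j₁))) (1 / (u j₂ * (1 - u j₂))))
    {n : ℕ} (hn : 1 ≤ n) {ω : Ω}
    (hU : ∀ i j, Uv P X i ω j ∈ Set.Ioo (0 : ℝ) 1) {M B w w' δ : ℝ} (hM0 : 0 ≤ M)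
    (hB0 : 0 ≤ B) (hw0 : 0 < w) (hww' : w ≤ (1 / 2 + w) * w') (hw'1 : w' < 1 / 2)
    (hM : ∀ p q : Fin d → ℝ, p ∈ Set.Icc 0 1 → q ∈ Set.Icc 0 1 → dist p q ≤ δ →
      |alphan P X n p ω - alphan P X n q ω| ≤ M * max (dist p q ^ w) ((n : ℝ) ^ (-w)))
    (hB : ∀ j, ∀ s ∈ Set.Ioo ((n : ℝ) ^ (-(1 / 2 + w))) (1 - (n : ℝ) ^ (-(1 / 2 + w))),
      |betanj P X n j s ω| ≤ B * (s * (1 - s)) ^ w')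
    (hn3 : 3 * (n : ℝ) ^ (-(1 / 2 + w)) < 1)
    (hδ : (2 + 2 * B) * (n : ℝ) ^ (-(1 / 2 : ℝ)) ≤ δ)
    (hsmall : 2 * B * (n : ℝ) ^ (-(1 / 2 : ℝ)) ≤ ((n : ℝ) ^ (-(1 / 2 + w)) / 2) ^ (1 - w'))
    {u : Fin d → ℝ} (hu : ∀ j, (n : ℝ) ^ (-(1 / 2 : ℝ)) < u j ∧ u j ≤ 1) :
    |CPgi P X n u ω - Cbar P X n u ω| ≤
      (1 + 2 * d) *
          (M * max (((2 + 2 * B) * (n : ℝ) ^ (-(1 / 2 : ℝ))) ^ w) ((n : ℝ) ^ (-w))) +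
        d * (n : ℝ) ^ (-(1 / 2 : ℝ)) + 2 * d * (2 + 2 * B) * (n : ℝ) ^ (-w) +
        8 * K * d ^ 2 * B ^ 2 *
          ((n : ℝ) ^ (-(1 / 2 : ℝ)) * ((n : ℝ) ^ (-(1 / 2 + w)) / 2) ^ (2 * w' - 1)) := by
  have hN1 : (1 : ℝ) ≤ n := by exact_mod_cast hn
  have hN : (0 : ℝ) < n := by linarith
  set r : ℝ := (n : ℝ) ^ (-(1 / 2 : ℝ)) with hr
  set q : ℝ := (n : ℝ) ^ (-(1 / 2 + w)) with hq
  have hr0 : 0 < r := Real.rpow_pos_of_pos hN _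
  have hq0 : 0 < q := Real.rpow_pos_of_pos hN _
  have hqr : q ≤ r := Real.rpow_le_rpow_of_exponent_le hN1 (by linarith)
  have hsqrt : Real.sqrt n * r = 1 := by
    rw [hr, Real.sqrt_eq_rpow, ← Real.rpow_add hN]; norm_num
  have hsqrtq : Real.sqrt n * q = (n : ℝ) ^ (-w) := by
    rw [hq, Real.sqrt_eq_rpow, ← Real.rpow_add hN]; congr 1; ring
  have hw'0 : 0 < w' := by
    by_contra h
    have : (1 / 2 + w) * w' ≤ 0 := mul_nonpos_of_nonneg_of_nonpos (by linarith) (not_lt.1 h)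
    linarith
  have hu0 : ∀ j, 0 < u j := fun j => hr0.trans (hu j).1
  set v : Fin d → ℝ := fun j => genInv (fun x => Gnj P X n j x ω) (u j) with hv
  have hv01 : ∀ j, v j ∈ Set.Ioo (0 : ℝ) 1 := fun j =>
    (exists_genInv_Gnj_eq hn (fun i => hU i j) (hu0 j) (hu j).2).1
  have hquant := fun j => abs_genInv_sub_le hn (fun i => hU i j) hB0 hw0 hww'
    (by linarith : w' ≤ 1) (hB j) hn3 (hu j).1 (hu j).2
  have hclose : ∀ j, |v j - u j| ≤ (2 + 2 * B) * r := by
    intro j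
    rcases le_or_gt (u j) (1 - 2 * q) with h | h
    · have h1 := (hquant j).1 h
      have h2 : (u j * (1 - u j)) ^ w' ≤ 1 :=
        Real.rpow_le_one (mul_nonneg (hu0 j).le (by linarith))
          (by nlinarith [hu0 j, (hu j).2]) hw'0.le
      have h3 := mul_le_mul_of_nonneg_left h2 (by positivity : 0 ≤ B * r)
      have h4 : 0 ≤ B * r := by positivity
      calc |v j - u j| ≤ _ := h1
        _ ≤ B * r * 1 := h3
        _ ≤ _ := by linarith
    · exact ((hquant j).2 h).trans (mul_le_mul_of_nonneg_left hqr (by linarith))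
  set D : ℝ := max (((2 + 2 * B) * r) ^ w) ((n : ℝ) ^ (-w)) with hD
  have hmod : ∀ p p' : Fin d → ℝ, p ∈ Set.Icc 0 1 → p' ∈ Set.Icc 0 1 →
      (∀ j, |p j - p' j| ≤ (2 + 2 * B) * r) →
      |alphan P X n p ω - alphan P X n p' ω| ≤ M * D := by
    intro p p' hp hp' hpp
    have h1 : dist p p' ≤ (2 + 2 * B) * r := (dist_pi_le_iff (by positivity)).2 hpp
    refine (hM p p' hp hp' (h1.trans hδ)).trans (mul_le_mul_of_nonneg_left ?_ hM0)
    exact max_le_max (Real.rpow_le_rpow dist_nonneg h1 hw0.le) le_rfl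
  have hαvu : |alphan P X n v ω - alphan P X n u ω| ≤ M * D :=
    hmod v u ⟨fun j => (hv01 j).1.le, fun j => (hv01 j).2.le⟩
      ⟨fun j => (hu0 j).le, fun j => (hu j).2⟩ hclose
  have hbahadur : ∀ j, |Real.sqrt n * (v j - u j) +
      alphan P X n (Function.update (fun _ => (1 : ℝ)) j (u j)) ω| ≤ 2 * (M * D) + r := by
    intro j
    have hmem : ∀ t : ℝ, 0 ≤ t → t ≤ 1 →
        Function.update (fun _ => (1 : ℝ)) j t ∈ Set.Icc (0 : Fin d → ℝ) 1 := by
      intro t h0 h1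
      refine ⟨fun k => ?_, fun k => ?_⟩ <;> by_cases hk : k = j
      · subst hk; simpa using h0
      · simp [Function.update_of_ne hk]
      · subst hk; simpa using h1
      · simp [Function.update_of_ne hk]
    have h1 := hmod (Function.update (fun _ => (1 : ℝ)) j (v j))
      (Function.update (fun _ => (1 : ℝ)) j (u j)) (hmem _ (hv01 j).1.le (hv01 j).2.le)
      (hmem _ (hu0 j).le (hu j).2) (fun k => by
        by_cases hk : k = j
        · subst hk; simpa using hclose k
        · simp only [Function.update_of_ne hk, sub_self, abs_zero]; positivity)
    obtain ⟨h2, h3⟩ := sqrt_mul_Gnj_genInv_sub_mem hmeas hcont hn (fun i => hU i j) hM0 hw0.le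
      hM (le_trans (by
        rw [← Real.rpow_neg_one]
        have : (n : ℝ) ^ (-1 : ℝ) ≤ r := Real.rpow_le_rpow_of_exponent_le hN1 (by norm_num)
        have : 0 ≤ B * r := by positivity
        linarith) hδ) (hu0 j) (hu j).2
    change 0 ≤ Real.sqrt n * (Gnj P X n j (v j) ω - u j) at h2
    change Real.sqrt n * (Gnj P X n j (v j) ω - u j) ≤ _ at h3
    have h4 : M * (n : ℝ) ^ (-w) ≤ M * D := mul_le_mul_of_nonneg_left (le_max_right _ _) hM0
    have h5 : Real.sqrt n * (v j - u j) +
        alphan P X n (Function.update (fun _ => (1 : ℝ)) j (u j)) ω =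
        Real.sqrt n * (Gnj P X n j (v j) ω - u j) -
          (alphan P X n (Function.update (fun _ => (1 : ℝ)) j (v j)) ω -
            alphan P X n (Function.update (fun _ => (1 : ℝ)) j (u j)) ω) := by
      rw [alphan, alphan, Gn_update_one, Gn_update_one,
        cop_update_one hmeas hcont j ⟨(hv01 j).1.le, (hv01 j).2.le⟩,
        cop_update_one hmeas hcont j ⟨(hu0 j).le, (hu j).2⟩]
      ring
    rw [h5]
    have h6 := abs_le.1 h1
    exact abs_le.2 ⟨by linarith [h6.2], by linarith [h6.1]⟩
  set J : Finset (Fin d) := Finset.univ.filter fun j => u j ≤ 1 - 2 * q with hJ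
  set ρ : ℝ := r * (q / 2) ^ (2 * w' - 1) with hρ
  have hgood : ∀ j ∈ J, 0 < u j ∧ u j < 1 ∧ |v j - u j| ≤ u j * (1 - u j) / 2 ∧
      Real.sqrt n * (|v j - u j| ^ 2 / (u j * (1 - u j))) ≤ B ^ 2 * ρ := by
    intro j hj
    have huj : u j ≤ 1 - 2 * q := (Finset.mem_filter.1 hj).2
    set t := u j * (1 - u j) with ht
    have hqt : q / 2 ≤ t := by
      have h1 := (hu j).1
      rcases le_total (u j) (1 / 2) with h | h <;> nlinarith
    have ht0 : 0 < t := by linarith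
    have h1 : |v j - u j| ≤ B * r * t ^ w' := (hquant j).1 huj
    have h2 : 2 * B * r ≤ t ^ (1 - w') :=
      hsmall.trans (Real.rpow_le_rpow (by positivity) hqt (by linarith))
    have h3 : t ^ w' * t ^ (1 - w') = t := by
      rw [← Real.rpow_add ht0]; simp
    have htw : 0 < t ^ w' := Real.rpow_pos_of_pos ht0 _
    refine ⟨hu0 j, by linarith, ?_, ?_⟩
    · have := mul_le_mul_of_nonneg_left h2 htw.le
      linarith
    · have h4 : |v j - u j| ^ 2 ≤ (B * r * t ^ w') ^ 2 :=
        pow_le_pow_left₀ (abs_nonneg _) h1 2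
      have h5 : (t ^ w') ^ 2 / t = t ^ (2 * w' - 1) := by
        rw [Real.rpow_sub ht0, Real.rpow_one, ← Real.rpow_natCast, ← Real.rpow_mul ht0.le]
        congr 2; push_cast; ring
      have h6 : t ^ (2 * w' - 1) ≤ (q / 2) ^ (2 * w' - 1) :=
        Real.rpow_le_rpow_of_nonpos (by positivity) hqt (by linarith)
      calc Real.sqrt n * (|v j - u j| ^ 2 / t) ≤ Real.sqrt n * ((B * r * t ^ w') ^ 2 / t) := by
            gcongr
        _ = (Real.sqrt n * r) * (B ^ 2 * (r * ((t ^ w') ^ 2 / t))) := by ring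
        _ = B ^ 2 * (r * t ^ (2 * w' - 1)) := by rw [hsqrt, h5, one_mul]
        _ ≤ B ^ 2 * ρ := by rw [hρ]; gcongr
  have htaylor := abs_taylor_remainder_le hder hder2 hK hbound
    (abs_cop_sub_update_le hmeas hcont) (abs_Cdot_cop_le_one hmeas hcont)
    (u := u) (v := v) (fun j => ⟨(hu0 j).le, (hu j).2⟩) J
    (fun j hj => ⟨(hgood j hj).1, (hgood j hj).2.1, (hgood j hj).2.2.1⟩)
  have hcard : ∀ S : Finset (Fin d), (S.card : ℝ) ≤ d := by
    intro S
    have := Finset.card_le_univ S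
    simp only [Fintype.card_fin] at this
    exact_mod_cast this
  have hρ0 : 0 ≤ ρ := by positivity
  have hrem : |Real.sqrt n * (cop P X v - cop P X u -
      ∑ j, Cdot (cop P X) j u * (v j - u j))| ≤
      2 * d * (2 + 2 * B) * (n : ℝ) ^ (-w) + 8 * K * d ^ 2 * B ^ 2 * ρ := by
    rw [abs_mul, abs_of_nonneg (Real.sqrt_nonneg _)]
    refine (mul_le_mul_of_nonneg_left htaylor (Real.sqrt_nonneg _)).trans ?_
    rw [mul_add]
    refine add_le_add ?_ ?_
    · rw [Finset.mul_sum]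
      calc _ ≤ ∑ j ∈ Jᶜ, 2 * (2 + 2 * B) * (n : ℝ) ^ (-w) := by
            refine Finset.sum_le_sum fun j hj => ?_
            have huj : 1 - 2 * q < u j := by simpa [hJ] using hj
            have h1 : |v j - u j| ≤ (2 + 2 * B) * q := (hquant j).2 huj
            calc Real.sqrt n * (2 * |v j - u j|) ≤ Real.sqrt n * (2 * ((2 + 2 * B) * q)) := by
                  gcongr
              _ = _ := by rw [← hsqrtq]; ring
        _ = (Jᶜ.card : ℝ) * (2 * (2 + 2 * B) * (n : ℝ) ^ (-w)) := by simp
        _ ≤ d * (2 * (2 + 2 * B) * (n : ℝ) ^ (-w)) :=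
            mul_le_mul_of_nonneg_right (hcard _) (by positivity)
        _ = _ := by ring
    · calc _ = 8 * K * d * ∑ j ∈ J, Real.sqrt n * (|v j - u j| ^ 2 / (u j * (1 - u j))) := by
            rw [← Finset.mul_sum]; ring
        _ ≤ 8 * K * d * ∑ _j ∈ J, B ^ 2 * ρ :=
            mul_le_mul_of_nonneg_left (Finset.sum_le_sum fun j hj => (hgood j hj).2.2.2)
              (by positivity)
        _ = 8 * K * d * ((J.card : ℝ) * (B ^ 2 * ρ)) := by simp
        _ ≤ 8 * K * d * (d * (B ^ 2 * ρ)) := by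
            have := mul_le_mul_of_nonneg_right (hcard J) (by positivity : 0 ≤ B ^ 2 * ρ)
            exact mul_le_mul_of_nonneg_left this (by positivity)
        _ = _ := by ring
  have hlin : |∑ j, Cdot (cop P X) j u * (Real.sqrt n * (v j - u j) +
      alphan P X n (Function.update (fun _ => (1 : ℝ)) j (u j)) ω)| ≤
      d * (2 * (M * D) + r) := by
    refine (Finset.abs_sum_le_sum_abs _ _).trans ?_
    calc _ ≤ ∑ _j : Fin d, (2 * (M * D) + r) := by
          refine Finset.sum_le_sum fun j _ => ?_
          rw [abs_mul]
          exact (mul_le_of_le_one_left (abs_nonneg _)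
            (abs_Cdot_cop_le_one hmeas hcont j u)).trans (hbahadur j)
      _ = _ := by rw [Finset.sum_const, nsmul_eq_mul]; simp
  have hdecomp : CPgi P X n u ω - Cbar P X n u ω =
      (alphan P X n v ω - alphan P X n u ω) +
      Real.sqrt n * (cop P X v - cop P X u - ∑ j, Cdot (cop P X) j u * (v j - u j)) +
      ∑ j, Cdot (cop P X) j u * (Real.sqrt n * (v j - u j) +
        alphan P X n (Function.update (fun _ => (1 : ℝ)) j (u j)) ω) := by
    have h1 : ∑ j, Cdot (cop P X) j u * (Real.sqrt n * (v j - u j) +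
        alphan P X n (Function.update (fun _ => (1 : ℝ)) j (u j)) ω) =
        Real.sqrt n * ∑ j, Cdot (cop P X) j u * (v j - u j) +
        ∑ j, Cdot (cop P X) j u *
          alphan P X n (Function.update (fun _ => (1 : ℝ)) j (u j)) ω := by
      rw [Finset.mul_sum, ← Finset.sum_add_distrib]
      exact Finset.sum_congr rfl fun j _ => by ring
    have h2 : CPgi P X n u ω = Real.sqrt n * (Gn P X n v ω - cop P X u) := rfl
    have h3 : alphan P X n v ω = Real.sqrt n * (Gn P X n v ω - cop P X v) := rfl
    rw [h1, h2, h3, Cbar]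
    ring
  rw [hdecomp]
  refine (abs_add_three _ _ _).trans ?_
  linarith

end Comparison

lemma tendsto_natCast_rpow_zero {a : ℝ} (ha : a < 0) :
    Tendsto (fun n : ℕ => (n : ℝ) ^ a) atTop (nhds 0) := by
  have := (tendsto_rpow_neg_atTop (neg_pos.2 ha)).comp tendsto_natCast_atTop_atTop
  simpa [Function.comp_def] using this

/-- The rates entering the deterministic comparison bound are asymptotically negligible. -/
lemma eventually_rates (d : ℕ) (K : ℝ) {B w w' ε : ℝ} (hw0 : 0 < w) (hw1 : w < 1 / 2)
    (hww' : w < (1 / 2 + w) * w') (hε : 0 < ε) :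
    ∀ᶠ n : ℕ in atTop, 3 * (n : ℝ) ^ (-(1 / 2 + w)) < 1 ∧
      (2 + 2 * B) * (n : ℝ) ^ (-(1 / 2 : ℝ)) ≤ (n : ℝ) ^ (-(1 / 4 : ℝ)) ∧
      2 * B * (n : ℝ) ^ (-(1 / 2 : ℝ)) ≤ ((n : ℝ) ^ (-(1 / 2 + w)) / 2) ^ (1 - w') ∧
      (n : ℝ) ^ (w / 2) * (d * (n : ℝ) ^ (-(1 / 2 : ℝ)) +
        2 * d * (2 + 2 * B) * (n : ℝ) ^ (-w) +
        8 * K * d ^ 2 * B ^ 2 *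
          ((n : ℝ) ^ (-(1 / 2 : ℝ)) * ((n : ℝ) ^ (-(1 / 2 + w)) / 2) ^ (2 * w' - 1))) ≤ ε := by
  have e1 : ∀ᶠ n : ℕ in atTop, 3 * (n : ℝ) ^ (-(1 / 2 + w)) < 1 := by
    have := (tendsto_natCast_rpow_zero (a := -(1 / 2 + w)) (by linarith)).const_mul 3
    exact this.eventually_lt_const (by norm_num)
  have e2 : ∀ᶠ n : ℕ in atTop, (2 + 2 * B) * (n : ℝ) ^ (-(1 / 4 : ℝ)) < 1 := by
    have := (tendsto_natCast_rpow_zero (a := -(1 / 4 : ℝ)) (by norm_num)).const_mul (2 + 2 * B)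
    exact this.eventually_lt_const (by norm_num)
  have e3 : ∀ᶠ n : ℕ in atTop,
      2 * B * (n : ℝ) ^ (w - (1 / 2 + w) * w') < (1 / 2 : ℝ) ^ (1 - w') := by
    have := (tendsto_natCast_rpow_zero (a := w - (1 / 2 + w) * w') (by linarith)).const_mul
      (2 * B)
    refine this.eventually_lt_const ?_
    rw [mul_zero]; positivity
  have e4 : ∀ᶠ n : ℕ in atTop, d * (n : ℝ) ^ (w / 2 - 1 / 2) +
      2 * d * (2 + 2 * B) * (n : ℝ) ^ (-(w / 2)) +
      8 * K * d ^ 2 * B ^ 2 * (1 / 2 : ℝ) ^ (2 * w' - 1) *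
        (n : ℝ) ^ (3 / 2 * w - 2 * ((1 / 2 + w) * w')) < ε := by
    have h1 := (tendsto_natCast_rpow_zero (a := w / 2 - 1 / 2) (by linarith)).const_mul (d : ℝ)
    have h2 := (tendsto_natCast_rpow_zero (a := -(w / 2)) (by linarith)).const_mul
      (2 * d * (2 + 2 * B))
    have h3 := (tendsto_natCast_rpow_zero (a := 3 / 2 * w - 2 * ((1 / 2 + w) * w'))
      (by linarith)).const_mul (8 * K * d ^ 2 * B ^ 2 * (1 / 2 : ℝ) ^ (2 * w' - 1))
    refine ((h1.add h2).add h3).eventually_lt_const ?_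
    simpa using hε
  filter_upwards [e1, e2, e3, e4, eventually_ge_atTop 1] with n h1 h2 h3 h4 hn
  have hN : (0 : ℝ) < n := by exact_mod_cast hn
  have hhalf : ∀ a : ℝ, ((n : ℝ) ^ (-(1 / 2 + w)) / 2) ^ a =
      (n : ℝ) ^ (-(1 / 2 + w) * a) * (1 / 2 : ℝ) ^ a := by
    intro a
    rw [div_eq_mul_one_div, Real.mul_rpow (by positivity) (by norm_num), Real.rpow_mul hN.le]
  refine ⟨h1, ?_, ?_, ?_⟩
  · have : (n : ℝ) ^ (-(1 / 2 : ℝ)) = (n : ℝ) ^ (-(1 / 4 : ℝ)) * (n : ℝ) ^ (-(1 / 4 : ℝ)) := by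
      rw [← Real.rpow_add hN]; norm_num
    rw [this, ← mul_assoc]
    exact mul_le_of_le_one_left (by positivity) h2.le
  · rw [hhalf]
    have : (n : ℝ) ^ (-(1 / 2 : ℝ)) =
        (n : ℝ) ^ (-(1 / 2 + w) * (1 - w')) * (n : ℝ) ^ (w - (1 / 2 + w) * w') := by
      rw [← Real.rpow_add hN]; congr 1; ring
    rw [this]
    have := mul_le_mul_of_nonneg_left h3.le
      (by positivity : 0 ≤ (n : ℝ) ^ (-(1 / 2 + w) * (1 - w')))
    linarith
  · rw [hhalf]
    refine le_trans (le_of_eq ?_) h4.le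
    have a1 : (n : ℝ) ^ (w / 2) * (n : ℝ) ^ (-(1 / 2 : ℝ)) = (n : ℝ) ^ (w / 2 - 1 / 2) := by
      rw [← Real.rpow_add hN]; congr 1
    have a2 : (n : ℝ) ^ (w / 2) * (n : ℝ) ^ (-w) = (n : ℝ) ^ (-(w / 2)) := by
      rw [← Real.rpow_add hN]; congr 1; ring
    have a3 : (n : ℝ) ^ (w / 2 - 1 / 2) * (n : ℝ) ^ (-(1 / 2 + w) * (2 * w' - 1)) =
        (n : ℝ) ^ (3 / 2 * w - 2 * ((1 / 2 + w) * w')) := by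
      rw [← Real.rpow_add hN]; congr 1; ring
    rw [← a3, ← a2, ← a1]
    ring

lemma abs_alphan_sub_le_of_Mn_le {P : Measure Ω} [IsProbabilityMeasure P]
    {X : ℤ → Ω → Fin d → ℝ} {n : ℕ} (hn : 1 ≤ n) {δ w M : ℝ} {ω : Ω}
    (hM : |Mn P X n δ w ω| ≤ M) {p q : Fin d → ℝ} (hp : p ∈ Set.Icc 0 1) (hq : q ∈ Set.Icc 0 1)
    (hpq : dist p q ≤ δ) :
    |alphan P X n p ω - alphan P X n q ω| ≤ M * max (dist p q ^ w) ((n : ℝ) ^ (-w)) := by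
  have hN : (0 : ℝ) < n := by exact_mod_cast hn
  have hpos : 0 < (n : ℝ) ^ (-w) := Real.rpow_pos_of_pos hN _
  have h := le_biSup_of_bounded
    (S := {q : (Fin d → ℝ) × (Fin d → ℝ) |
      q.1 ∈ Set.Icc 0 1 ∧ q.2 ∈ Set.Icc 0 1 ∧ dist q.1 q.2 ≤ δ})
    (f := fun q => |alphan P X n q.1 ω - alphan P X n q.2 ω| /
      max (dist q.1 q.2 ^ w) ((n : ℝ) ^ (-w)))
    (c := (Real.sqrt n + Real.sqrt n) / (n : ℝ) ^ (-w)) (by positivity) (by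
      intro q _
      refine div_le_div₀ (by positivity) ?_ hpos (le_max_right _ _)
      exact (abs_sub _ _).trans (add_le_add (abs_alphan_le n _ ω) (abs_alphan_le n _ ω)))
    (q := (p, q)) ⟨hp, hq, hpq⟩
  exact (div_le_iff₀ (hpos.trans_le (le_max_right _ _))).1
    (h.trans ((le_abs_self _).trans hM))

lemma abs_betanj_le_of_iSup_le {P : Measure Ω}
    {X : ℤ → Ω → Fin d → ℝ} {n : ℕ} (hn : 1 ≤ n) {lam w B : ℝ} {ω : Ω} {j : Fin d} (hw : 0 ≤ w)
    (hU : ∀ i, Uv P X i ω j ∈ Set.Ioo (0 : ℝ) 1)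
    (hB : |⨆ s ∈ Set.Ioo ((n : ℝ) ^ (-lam)) (1 - (n : ℝ) ^ (-lam)),
      |betanj P X n j s ω| / (s * (1 - s)) ^ w| ≤ B)
    {s : ℝ} (hs : s ∈ Set.Ioo ((n : ℝ) ^ (-lam)) (1 - (n : ℝ) ^ (-lam))) :
    |betanj P X n j s ω| ≤ B * (s * (1 - s)) ^ w := by
  have hN : (0 : ℝ) < n := by exact_mod_cast hn
  set q := (n : ℝ) ^ (-lam) with hq
  have hpos : 0 < q := Real.rpow_pos_of_pos hN _
  have h := le_biSup_of_bounded (S := Set.Ioo q (1 - q))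
    (f := fun s => |betanj P X n j s ω| / (s * (1 - s)) ^ w)
    (c := Real.sqrt n / (q * q) ^ w) (by positivity) (by
      intro t ht
      refine div_le_div₀ (by positivity) ?_ (by positivity) ?_
      · have hv := (exists_genInv_Gnj_eq hn hU (hpos.trans ht.1)
          (by linarith [ht.2] : t ≤ 1)).1
        rw [betanj, abs_mul, abs_of_nonneg (Real.sqrt_nonneg _)]
        refine mul_le_of_le_one_right (Real.sqrt_nonneg _) (abs_le.2 ⟨?_, ?_⟩) <;>
          linarith [hv.1, hv.2, ht.1, ht.2]
      · exact Real.rpow_le_rpow (by positivity)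
          (mul_le_mul ht.1.le (by linarith [ht.2]) hpos.le (hpos.trans ht.1).le) hw)
    hs
  have hs0 : 0 < s * (1 - s) :=
    mul_pos (hpos.trans hs.1) (by linarith [hs.2])
  exact (div_le_iff₀ (Real.rpow_pos_of_pos hs0 _)).1 (h.trans ((le_abs_self _).trans hB))

/-- Lemma 4.7: weighted approximation of `𝔺_n` by `C̄_n` on `N(n^{-1/2}, 1/2)`. -/
theorem weighted_comparison_CPgi_Cbar
    {Ω : Type*} [MeasurableSpace Ω] {d : ℕ} (hd : 2 ≤ d)
    (P : Measure Ω) [IsProbabilityMeasure P] (X : ℤ → Ω → Fin d → ℝ)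
    (hmeas : ∀ i, Measurable (X i)) (hstat : StrictlyStationary P X)
    (hcont : ∀ j, Continuous (margF P X j))
    (θ₁ θ₂ θ₃ : ℝ) (hθ₁ : θ₁ ∈ Set.Ioc (0 : ℝ) (1/2)) (hθ₂ : θ₂ ∈ Set.Ioc (0 : ℝ) (1/2))
    (hθ₃ : θ₃ ∈ Set.Ioc (1/2 : ℝ) 1)
    (hC : Condition21 (cop P X)) (h41 : Condition41 P X θ₁) (h43 : Condition43 P X θ₂ θ₃) :
    ∀ w ∈ Set.Ioo (0 : ℝ) (min (θ₁ / (2 * (1 - θ₁))) (min (θ₂ / (2 * (1 - θ₂))) (θ₃ - 1/2))),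
      oP1 P (fun n ω =>
        ⨆ u ∈ NN d ((n : ℝ) ^ (-(1/2 : ℝ))) (1/2),
          |CPgi P X n u ω / gW w u - Cbar P X n u ω / gW w u|) := by
  intro w hw
  obtain ⟨hw0, hw⟩ := hw
  obtain ⟨hwθ₁, hw⟩ := lt_min_iff.1 hw
  obtain ⟨hwθ₂, hwθ₃⟩ := lt_min_iff.1 hw
  have hwθ₁' : w < θ₁ := by
    refine hwθ₁.trans_le ((div_le_iff₀ (by linarith [hθ₁.2])).2 ?_)
    nlinarith [hθ₁.1, hθ₁.2]
  have hw1 : w < 1 / 2 := hwθ₁'.trans_le hθ₁.2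
  -- an exponent for the quantile process between `2w/(1+2w)` and `θ₂`
  obtain ⟨w', hw'lo, hw'θ⟩ : ∃ w', w / (1 / 2 + w) < w' ∧ w' < θ₂ := by
    refine exists_between ((div_lt_iff₀ (by linarith)).2 ?_)
    have := (lt_div_iff₀ (by linarith [hθ₂.2] : (0 : ℝ) < 2 * (1 - θ₂))).1 hwθ₂
    nlinarith
  have hww' : w < (1 / 2 + w) * w' := by
    have := (div_lt_iff₀ (by linarith : (0 : ℝ) < 1 / 2 + w)).1 hw'lo
    linarith
  have hw'0 : 0 < w' := (by positivity : 0 < w / (1 / 2 + w)).trans hw'lo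
  have hw'1 : w' < 1 / 2 := hw'θ.trans_le hθ₂.2
  obtain ⟨hder, -, Cdd, hder2, -, K, hK, hbound⟩ := hC
  have hd0 : (0 : ℝ) < d := by
    have : 0 < d := by omega
    exact_mod_cast this
  intro ε hε
  rw [ENNReal.tendsto_nhds_zero]
  intro η hη
  set η' : ℝ := (min η 1).toReal with hη'
  have hmin : min η 1 ≠ ⊤ := ne_top_of_le_ne_top ENNReal.one_ne_top (min_le_right _ _)
  have hη'0 : 0 < η' := ENNReal.toReal_pos (lt_min hη zero_lt_one).ne' hmin
  have hη'le : ENNReal.ofReal η' ≤ η := by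
    rw [hη', ENNReal.ofReal_toReal hmin]; exact min_le_left _ _
  have hβ := fun j => (h43 w' ⟨hw'0, hw'θ⟩ (1 / 2 + w) ⟨by linarith, by linarith⟩ j).2
    (η' / (2 * d)) (by positivity)
  choose Bj hBj using hβ
  set B : ℝ := ∑ j, |Bj j| with hBdef
  have hB0 : 0 ≤ B := Finset.sum_nonneg fun j _ => abs_nonneg _
  have hBjB : ∀ j, Bj j ≤ B := fun j => (le_abs_self _).trans
    (Finset.single_le_sum (f := fun j => |Bj j|) (fun i _ => abs_nonneg _) (Finset.mem_univ j))
  set M : ℝ := ε / 2 / ((1 + 2 * d) * (2 + 2 * B) ^ w) with hMdef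
  have hM0 : 0 < M := by positivity
  have hMn := h41 w ⟨hw0, hwθ₁'⟩ (fun n => (n : ℝ) ^ (-(1 / 4 : ℝ)))
    (tendsto_natCast_rpow_zero (by norm_num)) M hM0
  rw [ENNReal.tendsto_nhds_zero] at hMn
  have hMn' := hMn (ENNReal.ofReal (η' / 2)) (ENNReal.ofReal_pos.2 (by positivity))
  filter_upwards [eventually_ge_atTop 1, hMn', eventually_all.2 hBj,
    eventually_rates d K (B := B) hw0 hw1 hww' (half_pos hε)] with n hn hPM hPβ hrates
  obtain ⟨hr1, hr2, hr3, hr4⟩ := hrates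
  have hN1 : (1 : ℝ) ≤ n := by exact_mod_cast hn
  have hN : (0 : ℝ) < n := by linarith
  set A : Set Ω := {ω | ¬ ∀ (i : ℤ) (j : Fin d), Uv P X i ω j ∈ Set.Ioo (0 : ℝ) 1} with hA
  have hPA : P A = 0 := ae_iff.1 (ae_Uv_mem_Ioo hmeas hstat hcont)
  refine le_trans (measure_mono (t := A ∪
    ({ω | M * 1 < |Mn P X n ((n : ℝ) ^ (-(1 / 4 : ℝ))) w ω|} ∪
      ⋃ j, {ω | Bj j < |⨆ s ∈ Set.Ioo ((n : ℝ) ^ (-(1 / 2 + w))) (1 - (n : ℝ) ^ (-(1 / 2 + w))),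
        |betanj P X n j s ω| / (s * (1 - s)) ^ w'|})) ?_) ?_
  · intro ω hω
    by_contra hnot
    simp only [Set.mem_union, Set.mem_iUnion, Set.mem_ofPred_eq, not_or, not_exists, not_lt,
      hA, not_not] at hnot
    obtain ⟨hU, hMω, hβω⟩ := hnot
    rw [mul_one] at hMω
    rw [Set.mem_ofPred_eq] at hω
    refine absurd hω (not_lt.2 ?_)
    have hnonneg : 0 ≤ ⨆ u ∈ NN d ((n : ℝ) ^ (-(1 / 2 : ℝ))) (1 / 2),
        |CPgi P X n u ω / gW w u - Cbar P X n u ω / gW w u| :=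
      Real.iSup_nonneg fun u => Real.iSup_nonneg fun _ => abs_nonneg _
    rw [abs_of_nonneg hnonneg, mul_one]
    refine Real.iSup_le (fun u => Real.iSup_le (fun hu => ?_) hε.le) hε.le
    obtain ⟨hu01, hug, -⟩ := hu
    have hmain := abs_CPgi_sub_Cbar_le hmeas hcont hder hder2 hK hbound hn hU hM0.le hB0 hw0
      hww'.le hw'1 (fun p q hp hq hpq => abs_alphan_sub_le_of_Mn_le hn hMω hp hq hpq)
      (fun j s hs => abs_betanj_le_of_iSup_le hn hw'0.le (fun i => hU i j)
        ((hβω j).trans (hBjB j)) hs) hr1 hr2 hr3 (u := u)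
      (fun j => ⟨hug.trans_le ((min_le_left _ _).trans
        (ciInf_le (Set.finite_range u).bddBelow j)), (hu01 j).2⟩)
    have hr0 : 0 < (n : ℝ) ^ (-(1 / 2 : ℝ)) := Real.rpow_pos_of_pos hN _
    have hgle : (n : ℝ) ^ (-(w / 2)) ≤ gW w u := by
      calc (n : ℝ) ^ (-(w / 2)) = ((n : ℝ) ^ (-(1 / 2 : ℝ))) ^ w := by
            rw [← Real.rpow_mul hN.le]; congr 1; ring
        _ ≤ gW w u := Real.rpow_le_rpow hr0.le hug.le hw0.le
    have hpow : 0 < (n : ℝ) ^ (-(w / 2)) := Real.rpow_pos_of_pos hN _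
    have hg : 0 < gW w u := hpow.trans_le hgle
    rw [← sub_div, abs_div, abs_of_pos hg]
    refine (div_le_div_of_nonneg_left (abs_nonneg _) hpow hgle).trans ?_
    rw [Real.rpow_neg hN.le, div_inv_eq_mul, mul_comm]
    refine (mul_le_mul_of_nonneg_left hmain (by positivity)).trans ?_
    have hmax : (n : ℝ) ^ (w / 2) *
        max (((2 + 2 * B) * (n : ℝ) ^ (-(1 / 2 : ℝ))) ^ w) ((n : ℝ) ^ (-w)) ≤
          (2 + 2 * B) ^ w := by
      rw [mul_max_of_nonneg _ _ (by positivity)]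
      refine max_le (le_of_eq ?_) ?_
      · rw [Real.mul_rpow (by positivity) hr0.le, ← Real.rpow_mul hN.le, mul_left_comm,
          ← Real.rpow_add hN]
        have : w / 2 + -(1 / 2) * w = 0 := by ring
        rw [this, Real.rpow_zero, mul_one]
      · rw [← Real.rpow_add hN]
        exact (Real.rpow_le_one_of_one_le_of_nonpos hN1 (by linarith)).trans
          (Real.one_le_rpow (by linarith) hw0.le)
    have hfirst : (1 + 2 * d) * M * ((n : ℝ) ^ (w / 2) *
        max (((2 + 2 * B) * (n : ℝ) ^ (-(1 / 2 : ℝ))) ^ w) ((n : ℝ) ^ (-w))) ≤ ε / 2 := by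
      calc _ ≤ (1 + 2 * d) * M * (2 + 2 * B) ^ w :=
            mul_le_mul_of_nonneg_left hmax (by positivity)
        _ = ε / 2 := by
            have : (2 + 2 * B) ^ w ≠ 0 := (Real.rpow_pos_of_pos (by linarith) _).ne'
            have : (1 + 2 * (d : ℝ)) ≠ 0 := by positivity
            rw [hMdef]; field_simp
    linarith
  · refine (measure_union_le _ _).trans ?_
    rw [hPA, zero_add]
    refine (measure_union_le _ _).trans ?_
    refine le_trans (b := ENNReal.ofReal (η' / 2) + ENNReal.ofReal (η' / 2))
      (add_le_add hPM ((measure_iUnion_le _).trans ?_)) ?_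
    · rw [tsum_fintype]
      refine (Finset.sum_le_sum fun j _ => hPβ j).trans (le_of_eq ?_)
      rw [Finset.sum_const, Finset.card_univ, Fintype.card_fin, nsmul_eq_mul,
        ← ENNReal.ofReal_natCast, ← ENNReal.ofReal_mul hd0.le]
      congr 1
      field_simp
    · rw [← ENNReal.ofReal_add (by positivity) (by positivity), add_halves]
      exact hη'le

end BBV
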